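/- arXiv:2003.00335 — 5 statements merged into one kernel-verified Lean document; each statement's English description precedes it below -/
import Mathlib

section
/- Let f : ℝⁿ × ℝⁿ → ℝ be twice continuously differentiable, let A be a real m×n matrix of rank m, and let b ∈ ℝᵐ. Let x₀ ∈ ℝⁿ and suppose there are functions y* : ℝⁿ → ℝⁿ and λ* : ℝⁿ → ℝᵐ, both differentiable at x₀, satisfying the Lagrangian stationarity conditions ∇_y f(x, y*(x)) + Aᵀ λ*(x) = 0 and A y*(x) = b for all x in a neighborhood of x₀. Suppose the Hessian H = ∇²_{yy} f(x₀, y*(x₀)) is invertible and A H⁻¹ Aᵀ is invertible. Then the Jacobian of y* at x₀ is given by Dy*(x₀) = ( H⁻¹ Aᵀ (A H⁻¹ Aᵀ)⁻¹ A H⁻¹ − H⁻¹ ) · ∇²_{xy} f(x₀, y*(x₀)). -/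
open Filter

/-- The gradient of `f : ℝⁿ × ℝⁿ → ℝ` in its second argument, as a vector in `ℝⁿ`:
`gradSnd f x y i = ∂f/∂yᵢ (x, y)`. -/
noncomputable def gradSnd {n : ℕ} (f : (Fin n → ℝ) × (Fin n → ℝ) → ℝ)
    (x : Fin n → ℝ) (y : Fin n → ℝ) : Fin n → ℝ :=
  fun i => fderiv ℝ (fun y' => f (x, y')) y (Pi.single i 1)

/-- For a differentiable `f`, the partial gradient is read off from the full derivative. -/
lemma gradSnd_eq_fderiv {n : ℕ} {f : (Fin n → ℝ) × (Fin n → ℝ) → ℝ} (hf : Differentiable ℝ f)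
    (x y : Fin n → ℝ) : gradSnd f x y = fun i => fderiv ℝ f (x, y) (0, Pi.single i 1) := by
  funext i
  have h := (hf (x, y)).hasFDerivAt.comp y (hasFDerivAt_prodMk_right (𝕜 := ℝ) x y)
  have h' : fderiv ℝ (fun y' => f (x, y')) y = _ := h.fderiv
  simp [gradSnd, h']

/-- The partial gradient of a `C²` function is jointly differentiable. -/
lemma differentiable_gradSnd {n : ℕ} {f : (Fin n → ℝ) × (Fin n → ℝ) → ℝ} (hf : ContDiff ℝ 2 f) :
    Differentiable ℝ fun p : (Fin n → ℝ) × (Fin n → ℝ) => gradSnd f p.1 p.2 := by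
  simp_rw [gradSnd_eq_fderiv (hf.differentiable two_ne_zero)]
  have h : Differentiable ℝ (fderiv ℝ f) :=
    (hf.fderiv_right (m := 1) (by norm_num)).differentiable one_ne_zero
  rw [differentiable_pi]
  intro i
  exact h.clm_apply (differentiable_const _)

/-- The matrix of a derivative, computed entrywise from the coordinate functions. -/
lemma HasFDerivAt.of_fderiv_apply_single {n k : ℕ} {g : (Fin n → ℝ) → (Fin k → ℝ)}
    {g' : (Fin n → ℝ) →L[ℝ] (Fin k → ℝ)} {x : Fin n → ℝ} (h : HasFDerivAt g g' x) :
    (Matrix.of fun i j => fderiv ℝ (fun z => g z i) x (Pi.single j 1)) =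
      LinearMap.toMatrix' (g' : (Fin n → ℝ) →ₗ[ℝ] (Fin k → ℝ)) := by
  ext i j
  simp [(hasFDerivAt_pi'.1 h i).fderiv, LinearMap.toMatrix'_apply]

/-- Block elimination in the linearized KKT system `C + H K + Aᵀ L = 0`, `A K = 0`. -/
lemma Matrix.eq_of_kkt_system {ι κ μ R : Type*} [Fintype ι] [DecidableEq ι] [Fintype κ]
    [DecidableEq κ] [CommRing R] {A : Matrix κ ι R} {H : Matrix ι ι R} {C K : Matrix ι μ R}
    {L : Matrix κ μ R} (hH : IsUnit H.det) (hS : IsUnit (A * H⁻¹ * A.transpose).det)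
    (hstat : C + H * K + A.transpose * L = 0) (hfeas : A * K = 0) :
    K = (H⁻¹ * A.transpose * (A * H⁻¹ * A.transpose)⁻¹ * A * H⁻¹ - H⁻¹) * C := by
  have hK : K = -(H⁻¹ * C) - H⁻¹ * (A.transpose * L) := by
    have h := congrArg (H⁻¹ * ·) hstat
    simp only [Matrix.mul_add, Matrix.mul_zero, Matrix.nonsing_inv_mul_cancel_left _ _ hH] at h
    rw [← sub_eq_zero, ← h]
    abel
  have hL : L = -((A * H⁻¹ * A.transpose)⁻¹ * (A * (H⁻¹ * C))) := by
    have h : A * H⁻¹ * A.transpose * L = -(A * (H⁻¹ * C)) := by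
      rw [hK, Matrix.mul_sub, Matrix.mul_neg, sub_eq_zero] at hfeas
      simpa only [Matrix.mul_assoc] using hfeas.symm
    rw [← Matrix.mul_neg, ← h, Matrix.nonsing_inv_mul_cancel_left _ _ hS]
  rw [hK, hL]
  simp only [Matrix.sub_mul, Matrix.mul_neg, Matrix.mul_assoc]
  abel

/-- differentiation through a linearly constrained argmin (Gould et al.).
If `(y*(x), λ*(x))` satisfies the KKT stationarity conditions
`∇_y f(x, y*(x)) + Aᵀ λ*(x) = 0` and `A y*(x) = b` near `x₀`, with `rank A = m`,
`H = ∇²_{yy} f(x₀, y*(x₀))` invertible and `A H⁻¹ Aᵀ` invertible, then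
`Dy*(x₀) = (H⁻¹Aᵀ(AH⁻¹Aᵀ)⁻¹AH⁻¹ − H⁻¹) ∇²_{xy} f(x₀, y*(x₀))`. -/
theorem jacobian_of_argmin_linearly_constrained
    (n m : ℕ) (f : (Fin n → ℝ) × (Fin n → ℝ) → ℝ) (hf : ContDiff ℝ 2 f)
    (A : Matrix (Fin m) (Fin n) ℝ) (hA : A.rank = m) (b : Fin m → ℝ)
    (x₀ : Fin n → ℝ)
    (ystar : (Fin n → ℝ) → (Fin n → ℝ)) (lamstar : (Fin n → ℝ) → (Fin m → ℝ))
    (hystar : DifferentiableAt ℝ ystar x₀) (hlamstar : DifferentiableAt ℝ lamstar x₀)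
    (hstat : ∀ᶠ z in nhds x₀,
      gradSnd f z (ystar z) + A.transpose.mulVec (lamstar z) = 0 ∧
      A.mulVec (ystar z) = b)
    (H : Matrix (Fin n) (Fin n) ℝ)
    (hH : H = Matrix.of fun i j =>
      fderiv ℝ (fun y' => gradSnd f x₀ y' i) (ystar x₀) (Pi.single j 1))
    (hHinv : IsUnit H.det)
    (hAHAinv : IsUnit (A * H⁻¹ * A.transpose).det)
    (fXY : Matrix (Fin n) (Fin n) ℝ)
    (hfXY : fXY = Matrix.of fun i j =>
      fderiv ℝ (fun x' => gradSnd f x' (ystar x₀) i) x₀ (Pi.single j 1)) :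
    (Matrix.of fun i j => fderiv ℝ ystar x₀ (Pi.single j 1) i) =
      (H⁻¹ * A.transpose * (A * H⁻¹ * A.transpose)⁻¹ * A * H⁻¹ - H⁻¹) * fXY := by
  have hG := (differentiable_gradSnd hf (x₀, ystar x₀)).hasFDerivAt
  set G' := fderiv ℝ (fun p : (Fin n → ℝ) × (Fin n → ℝ) => gradSnd f p.1 p.2) (x₀, ystar x₀)
  have hy := hystar.hasFDerivAt
  have hl := hlamstar.hasFDerivAt
  have hHG := (hG.comp (ystar x₀) (hasFDerivAt_prodMk_right (𝕜 := ℝ) x₀ (ystar x₀)))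
  have hCG := (hG.comp x₀ (hasFDerivAt_prodMk_left (𝕜 := ℝ) x₀ (ystar x₀)))
  have hH' : H = _ := hH.trans hHG.of_fderiv_apply_single
  have hC' : fXY = _ := hfXY.trans hCG.of_fderiv_apply_single
  have hK : (Matrix.of fun i j => fderiv ℝ ystar x₀ (Pi.single j 1) i) =
      LinearMap.toMatrix' (fderiv ℝ ystar x₀ : (Fin n → ℝ) →ₗ[ℝ] (Fin n → ℝ)) := by
    ext i j
    simp [LinearMap.toMatrix'_apply]
  have hstat' := (hG.comp x₀ ((hasFDerivAt_id x₀).prodMk hy)).add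
    ((Matrix.mulVecLin A.transpose).toContinuousLinearMap.hasFDerivAt.comp x₀ hl)
  have hstat0 := hstat'.unique ((hasFDerivAt_const (0 : Fin n → ℝ) x₀).congr_of_eventuallyEq
    (hstat.mono fun z hz => hz.1))
  have hfeas0 := ((Matrix.mulVecLin A).toContinuousLinearMap.hasFDerivAt.comp x₀ hy).unique
    ((hasFDerivAt_const b x₀).congr_of_eventuallyEq (hstat.mono fun z hz => hz.2))
  refine Matrix.eq_of_kkt_system
    (L := LinearMap.toMatrix' (fderiv ℝ lamstar x₀ : (Fin n → ℝ) →ₗ[ℝ] (Fin m → ℝ)))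
    hHinv hAHAinv ?_ ?_
  · rw [hK, hH', hC', ← LinearMap.toMatrix'_toLin' A.transpose, ← LinearMap.toMatrix'_comp,
      ← LinearMap.toMatrix'_comp, ← map_add, ← map_add, LinearEquiv.map_eq_zero_iff]
    refine LinearMap.ext fun v => ?_
    have hv : G' (v, fderiv ℝ ystar x₀ v) + A.transpose.mulVec (fderiv ℝ lamstar x₀ v) = 0 :=
      congrArg (fun T => T v) hstat0
    have hsplit : G' (v, fderiv ℝ ystar x₀ v) = G' (v, 0) + G' (0, fderiv ℝ ystar x₀ v) := by
      rw [← map_add, Prod.mk_add_mk, add_zero, zero_add]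
    rw [hsplit] at hv
    exact hv
  · rw [hK, ← LinearMap.toMatrix'_toLin' A, ← LinearMap.toMatrix'_comp,
      LinearEquiv.map_eq_zero_iff]
    exact congrArg ContinuousLinearMap.toLinearMap hfeas0
end

section
/- The function x ↦ (arcosh x)² is concave on the interval [1, ∞); that is, for all x, y ∈ [1, ∞) and all λ ∈ [0, 1], (arcosh(λx + (1−λ)y))² ≥ λ·(arcosh x)² + (1−λ)·(arcosh y)². -/
/-- The inverse hyperbolic cosine, `arcosh x = log (x + √(x² − 1))` for `x ≥ 1`. -/
noncomputable def arcosh (x : ℝ) : ℝ := Real.log (x + Real.sqrt (x ^ 2 - 1))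

lemma convexOn_sinh_Ici : ConvexOn ℝ (Set.Ici 0) Real.sinh := by
  refine MonotoneOn.convexOn_of_deriv (convex_Ici 0) Real.continuous_sinh.continuousOn
    Real.differentiable_sinh.differentiableOn ?_
  rw [interior_Ici, Real.deriv_sinh]
  intro a ha b hb hab
  rwa [Real.cosh_le_cosh, abs_of_pos ha, abs_of_pos hb]

lemma mul_sinh_le_mul_sinh {a b : ℝ} (ha : 0 < a) (hab : a ≤ b) :
    b * Real.sinh a ≤ a * Real.sinh b := by
  have hb : 0 < b := ha.trans_le hab
  have h := convexOn_sinh_Ici.2 (Set.mem_Ici.2 hb.le) (Set.mem_Ici.2 le_rfl)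
    (div_nonneg ha.le hb.le) (sub_nonneg.2 ((div_le_one hb).2 hab)) (add_sub_cancel _ _)
  simp only [smul_eq_mul, mul_zero, add_zero, Real.sinh_zero, div_mul_cancel₀ a hb.ne'] at h
  rwa [div_mul_eq_mul_div, le_div_iff₀ hb, mul_comm] at h

lemma antitoneOn_div_sinh : AntitoneOn (fun t : ℝ ↦ t / Real.sinh t) (Set.Ioi 0) := by
  intro a ha b hb hab
  have h := mul_sinh_le_mul_sinh ha hab
  exact (div_le_div_iff₀ (Real.sinh_pos_iff.2 hb) (Real.sinh_pos_iff.2 ha)).2 h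

lemma hasDerivAt_arcosh_sq {x : ℝ} (hx : 1 < x) :
    HasDerivAt (fun y ↦ Real.arcosh y ^ 2)
      (2 * (Real.arcosh x / Real.sinh (Real.arcosh x))) x := by
  refine ((Real.hasDerivAt_arcosh hx).pow 2).congr_deriv ?_
  rw [Real.sinh_arcosh hx.le]
  push_cast
  ring

lemma concaveOn_real_arcosh_sq : ConcaveOn ℝ (Set.Ici 1) (fun x ↦ Real.arcosh x ^ 2) := by
  refine AntitoneOn.concaveOn_of_deriv (convex_Ici 1) (Real.continuousOn_arcosh.pow 2) ?_ ?_ <;>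
    rw [interior_Ici]
  · exact fun x hx ↦ (hasDerivAt_arcosh_sq hx).differentiableAt.differentiableWithinAt
  · intro x hx y hy hxy
    rw [(hasDerivAt_arcosh_sq hx).deriv, (hasDerivAt_arcosh_sq hy).deriv]
    have hle : Real.arcosh x ≤ Real.arcosh y :=
      (Real.arcosh_le_arcosh (one_pos.trans hx) (one_pos.trans hy)).2 hxy
    exact mul_le_mul_of_nonneg_left
      (antitoneOn_div_sinh (Real.arcosh_pos hx) (Real.arcosh_pos hy) hle) zero_le_two

/-- the function `x ↦ (arcosh x)²` is concave on `[1, ∞)`. -/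
theorem arcosh_sq_concaveOn :
    ∀ x ∈ Set.Ici (1 : ℝ), ∀ y ∈ Set.Ici (1 : ℝ), ∀ l : ℝ, 0 ≤ l → l ≤ 1 →
      l * (arcosh x) ^ 2 + (1 - l) * (arcosh y) ^ 2 ≤
        (arcosh (l * x + (1 - l) * y)) ^ 2 := by
  intro x hx y hy l hl hl'
  exact concaveOn_real_arcosh_sq.2 hx hy hl (sub_nonneg.2 hl') (add_sub_cancel _ _)
end

section
/- Let K < 0, let x⁽¹⁾, …, x⁽ᵗ⁾ ∈ ℝⁿ satisfy |K|·‖x⁽ˡ⁾‖² < 1 for every l (i.e. they lie in the Poincaré ball of curvature K), and let w₁, …, w_t > 0. On the open ball D = { y ∈ ℝⁿ : |K|·‖y‖² < 1 }, define the Fréchet objective f(y) = Σ_{l=1}^t (w_l/|K|)·arcosh( 1 + 2·|K|·‖x⁽ˡ⁾ − y‖² / ((1 − |K|·‖x⁽ˡ⁾‖²)(1 − |K|·‖y‖²)) )². Define the iteration: y₀ = x⁽¹⁾, and given y_k ∈ D, set α_l = w_l·G(v_l)/(1 − |K|·‖x⁽ˡ⁾‖²) with v_l = |K|·‖x⁽ˡ⁾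 − y_k‖² / ((1 − |K|·‖x⁽ˡ⁾‖²)(1 − |K|·‖y_k‖²)), where G(v) = 2·arcosh(1 + 2v)/√(v² + v) for v > 0 and G(0) = 4; set a = Σ_{l=1}^t α_l, b = Σ_{l=1}^t α_l·x⁽ˡ⁾, c = Σ_{l=1}^t α_l·‖x⁽ˡ⁾‖²; and set y_{k+1} = η·b with η = ((a + c·|K|) − √((a + c·|K|)² − 4·|K|·‖b‖²)) / (2·|K|·‖b‖²) if b ≠ 0, and y_{k+1} = 0 if b = 0. Suppose f attains its minimum over D at a unique point μ. Then every y_k lies in D and lim_{k→∞} y_k = μ. -/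
open Filter
open scoped Classical

/-- The continuous extension of `v ↦ 2 arcosh (1 + 2v) / √(v² + v)` to `v = 0`
(its value for `v < 0` is irrelevant; it is only used for `v ≥ 0`). -/
noncomputable def poincG (v : ℝ) : ℝ :=
  if v ≤ 0 then 4 else 2 * arcosh (1 + 2 * v) / Real.sqrt (v ^ 2 + v)

namespace PoincareFrechetMean

theorem arcosh_eq_real_arcosh : arcosh = Real.arcosh := rfl

/-- The function `sinh A / A`, extended by `1` at `A = 0`. -/
noncomputable def sinhc (A : ℝ) : ℝ := dslope Real.sinh 0 A

theorem mul_sinhc (A : ℝ) : A * sinhc A = Real.sinh A := by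
  simpa [sinhc] using sub_smul_dslope Real.sinh 0 A

theorem sinhc_zero : sinhc 0 = 1 := by simp [sinhc]

theorem continuous_sinhc : Continuous sinhc := by
  rw [← continuousOn_univ]
  exact (continuousOn_dslope Filter.univ_mem).2
    ⟨Real.continuous_sinh.continuousOn, Real.differentiable_sinh 0⟩

theorem sinhc_pos {A : ℝ} (hA : 0 ≤ A) : 0 < sinhc A := by
  rcases hA.eq_or_lt with rfl | h
  · simp [sinhc_zero]
  · exact pos_of_mul_pos_right (by rw [mul_sinhc]; exact Real.sinh_pos_iff.2 h) hA

theorem hasSum_sinhc (A : ℝ) :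
    HasSum (fun n : ℕ => A ^ (2 * n) / ((2 * n + 1).factorial : ℝ)) (sinhc A) := by
  rcases eq_or_ne A 0 with rfl | h
  · rw [sinhc_zero]
    convert hasSum_single (f := fun n : ℕ => (0 : ℝ) ^ (2 * n) / ((2 * n + 1).factorial : ℝ)) 0 ?_
      using 1
    · simp
    · intro n hn
      simp [hn]
  · rw [show sinhc A = Real.sinh A / A by rw [eq_div_iff h, mul_comm, mul_sinhc]]
    have hterm : (fun n : ℕ => A ^ (2 * n) / ((2 * n + 1).factorial : ℝ)) =
        fun n : ℕ => A ^ (2 * n + 1) / ((2 * n + 1).factorial : ℝ) / A := by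
      ext n
      rw [pow_succ]
      field_simp
    rw [hterm]
    exact (Real.hasSum_sinh A).div_const A

theorem pow_succ_tangent {u v : ℝ} (hu : 0 ≤ u) (hv : 0 ≤ v) (n : ℕ) :
    v ^ (n + 1) + (n + 1) * v ^ n * (u - v) ≤ u ^ (n + 1) := by
  induction n with
  | zero => simp
  | succ n ih =>
    have h := mul_le_mul_of_nonneg_left ih hu
    have h' : 0 ≤ ((n : ℝ) + 1) * v ^ n * (u - v) ^ 2 := by positivity
    push_cast
    calc v ^ (n + 1 + 1) + (n + 1 + 1) * v ^ (n + 1) * (u - v)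
        = u * (v ^ (n + 1) + (n + 1) * v ^ n * (u - v)) - (n + 1) * v ^ n * (u - v) ^ 2 := by ring
      _ ≤ u * u ^ (n + 1) := by linarith
      _ = u ^ (n + 1 + 1) := by ring

/-- The function `u ↦ cosh √u` lies above its tangent lines. -/
theorem cosh_tangent (A B : ℝ) :
    Real.cosh A + sinhc A / 2 * (B ^ 2 - A ^ 2) ≤ Real.cosh B := by
  have hs : ∀ x : ℝ, HasSum (fun n : ℕ => (x ^ 2) ^ (n + 1) / ((2 * (n + 1)).factorial : ℝ))
      (Real.cosh x - 1) := by
    intro x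
    have := (hasSum_nat_add_iff' 1).2 (Real.hasSum_cosh x)
    simpa [pow_mul] using this
  have hm := ((hasSum_sinhc A).div_const 2).mul_right (B ^ 2 - A ^ 2)
  have := hasSum_le (fun n => ?_) ((hs A).add hm) (hs B)
  · linarith
  · have hfac : ((2 * (n + 1)).factorial : ℝ) = 2 * (n + 1) * ((2 * n + 1).factorial : ℝ) := by
      rw [show 2 * (n + 1) = (2 * n + 1) + 1 by ring, Nat.factorial_succ]
      push_cast
      ring
    have hpos : (0 : ℝ) < (2 * n + 1).factorial := by positivity
    calc _ = ((A ^ 2) ^ (n + 1) + (n + 1) * (A ^ 2) ^ n * (B ^ 2 - A ^ 2)) /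
          ((2 * (n + 1)).factorial : ℝ) := by
          rw [hfac]
          field_simp
          ring
      _ ≤ _ := by
          gcongr
          exact pow_succ_tangent (sq_nonneg B) (sq_nonneg A) n

theorem cosh_arcosh_one_add {v : ℝ} (hv : 0 ≤ v) : Real.cosh (arcosh (1 + 2 * v)) = 1 + 2 * v :=
  Real.cosh_arcosh (by linarith)

theorem arcosh_one_add_nonneg {v : ℝ} (hv : 0 ≤ v) : 0 ≤ arcosh (1 + 2 * v) :=
  Real.arcosh_nonneg (by linarith)

theorem poincG_eq {v : ℝ} (hv : 0 ≤ v) : poincG v = 4 / sinhc (arcosh (1 + 2 * v)) := by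
  rcases hv.eq_or_lt with rfl | h
  · simp [poincG, arcosh, sinhc_zero]
  · have hA : 0 < arcosh (1 + 2 * v) := Real.arcosh_pos (by linarith)
    have hS := sinhc_pos hA.le
    have hsinh : Real.sinh (arcosh (1 + 2 * v)) = 2 * Real.sqrt (v ^ 2 + v) := by
      rw [arcosh_eq_real_arcosh, Real.sinh_arcosh (by linarith),
        show (1 + 2 * v) ^ 2 - 1 = 2 ^ 2 * (v ^ 2 + v) by ring, Real.sqrt_mul (by norm_num),
        Real.sqrt_sq (by norm_num)]
    have hsq : 0 < Real.sqrt (v ^ 2 + v) := Real.sqrt_pos.2 (by positivity)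
    rw [← mul_sinhc] at hsinh
    rw [poincG, if_neg h.not_ge, div_eq_div_iff hsq.ne' hS.ne']
    linarith

theorem poincG_pos {v : ℝ} (hv : 0 ≤ v) : 0 < poincG v := by
  rw [poincG_eq hv]
  exact div_pos (by norm_num) (sinhc_pos (arcosh_one_add_nonneg hv))

theorem continuousOn_arcosh_one_add :
    ContinuousOn (fun v => arcosh (1 + 2 * v)) (Set.Ici 0) :=
  Real.continuousOn_arcosh.comp (by fun_prop) fun v (hv : 0 ≤ v) => by
    simp only [Set.mem_Ici]; linarith

theorem continuousOn_poincG : ContinuousOn poincG (Set.Ici 0) := by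
  refine ContinuousOn.congr (f := fun v => 4 / sinhc (arcosh (1 + 2 * v))) ?_
    fun v hv => poincG_eq hv
  exact continuousOn_const.div (continuous_sinhc.comp_continuousOn continuousOn_arcosh_one_add)
    fun v hv => (sinhc_pos (arcosh_one_add_nonneg hv)).ne'

/-- The function `v ↦ arcosh (1 + 2 v) ^ 2` lies below its tangent lines, whose slopes are given
by `poincG`. -/
theorem sq_arcosh_le {u v : ℝ} (hu : 0 ≤ u) (hv : 0 ≤ v) :
    arcosh (1 + 2 * u) ^ 2 ≤ arcosh (1 + 2 * v) ^ 2 + poincG v * (u - v) := by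
  have h := cosh_tangent (arcosh (1 + 2 * v)) (arcosh (1 + 2 * u))
  rw [cosh_arcosh_one_add hu, cosh_arcosh_one_add hv] at h
  rw [poincG_eq hv, ← sub_le_iff_le_add', div_mul_eq_mul_div,
    le_div_iff₀ (sinhc_pos (arcosh_one_add_nonneg hv))]
  linarith

/-- A comparison of the hyperbolic law of cosines with the Euclidean one. -/
theorem sq_ge_of_law_of_cosines {E : Type*} [NormedAddCommGroup E] [InnerProductSpace ℝ E]
    {A B C : ℝ} (hA : 0 ≤ A) (hB : 0 ≤ B) {T U : E}
    (hT : ‖T‖ = Real.sinh A) (hU : ‖U‖ = Real.sinh B)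
    (hC : Real.cosh C = Real.cosh A * Real.cosh B - inner ℝ T U) :
    A ^ 2 + B ^ 2 - 2 * inner ℝ T U / (sinhc A * sinhc B) ≤ C ^ 2 := by
  obtain ⟨q, hq1, hq2, hq⟩ : ∃ q : ℝ, -1 ≤ q ∧ q ≤ 1 ∧
      inner ℝ T U = q * (Real.sinh A * Real.sinh B) := by
    have h := abs_real_inner_div_norm_mul_norm_le_one T U
    refine ⟨inner ℝ T U / (‖T‖ * ‖U‖), (abs_le.1 h).1, (abs_le.1 h).2, ?_⟩
    rw [← hT, ← hU]
    by_cases h0 : ‖T‖ * ‖U‖ = 0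
    · rcases mul_eq_zero.1 h0 with h0 | h0 <;> simp [norm_eq_zero.1 h0]
    · exact (div_mul_cancel₀ _ h0).symm
  have hcos : A ^ 2 + B ^ 2 - 2 * inner ℝ T U / (sinhc A * sinhc B)
      = A ^ 2 + B ^ 2 - 2 * q * (A * B) := by
    have := (sinhc_pos hA).ne'
    have := (sinhc_pos hB).ne'
    rw [hq, ← mul_sinhc, ← mul_sinhc]
    field_simp
  rw [hcos]
  have hnn : 0 ≤ A ^ 2 + B ^ 2 - 2 * q * (A * B) := by
    nlinarith [mul_nonneg hA hB, sq_nonneg (A - B), mul_nonneg (sub_nonneg.2 hq2) (mul_nonneg hA hB)]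
  set D := Real.sqrt (A ^ 2 + B ^ 2 - 2 * q * (A * B)) with hD
  have hD2 : D ^ 2 = A ^ 2 + B ^ 2 - 2 * q * (A * B) := Real.sq_sqrt hnn
  have h1 := mul_le_mul_of_nonneg_left (cosh_tangent D (A - B)) (by linarith : 0 ≤ 1 + q)
  have h2 := mul_le_mul_of_nonneg_left (cosh_tangent D (A + B)) (by linarith : 0 ≤ 1 - q)
  have hle : Real.cosh D ≤ Real.cosh C := by
    rw [Real.cosh_sub] at h1
    rw [Real.cosh_add] at h2
    rw [hC, hq]
    rw [hD2] at h1 h2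
    linarith
  rw [← hD2]
  exact sq_le_sq.2 (Real.cosh_le_cosh.1 hle)

variable {E ι : Type*} [NormedAddCommGroup E]

theorem norm_sq_lt_one {r : ℝ} {y : E} (hr : r < 1) (hy : ‖y‖ ≤ r) : ‖y‖ ^ 2 < 1 :=
  (sq_lt_one_iff₀ (norm_nonneg y)).2 (hy.trans_lt hr)

/-- The quantity `(cosh d(x, y) - 1) / 2` for the distance `d` of the unit Poincaré ball. -/
noncomputable def ballQuot (x y : E) : ℝ :=
  ‖x - y‖ ^ 2 / ((1 - ‖x‖ ^ 2) * (1 - ‖y‖ ^ 2))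

theorem ballQuot_nonneg {x y : E} (hx : ‖x‖ ^ 2 < 1) (hy : ‖y‖ ^ 2 < 1) : 0 ≤ ballQuot x y :=
  div_nonneg (sq_nonneg _) (mul_nonneg (by linarith) (by linarith))

theorem ballQuot_comm (x y : E) : ballQuot x y = ballQuot y x := by
  rw [ballQuot, ballQuot, norm_sub_rev, mul_comm]

theorem ballQuot_self (x : E) : ballQuot x x = 0 := by simp [ballQuot]

theorem continuousOn_ballQuot {a : E} (ha : ‖a‖ ^ 2 < 1) :
    ContinuousOn (ballQuot a) {y | ‖y‖ ^ 2 < 1} := by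
  unfold ballQuot
  refine ContinuousOn.div (by fun_prop) (by fun_prop) fun y (hy : ‖y‖ ^ 2 < 1) => ?_
  exact (mul_pos (by linarith) (by linarith)).ne'

/-- The Fréchet objective in the unit Poincaré ball. -/
noncomputable def frechetObj [Fintype ι] (w : ι → ℝ) (x : ι → E) (y : E) : ℝ :=
  ∑ l, w l * arcosh (1 + 2 * ballQuot (x l) y) ^ 2

theorem continuousOn_frechetObj [Fintype ι] {x : ι → E} (w : ι → ℝ) (hx : ∀ l, ‖x l‖ ^ 2 < 1) :
    ContinuousOn (frechetObj w x) {y | ‖y‖ ^ 2 < 1} := by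
  unfold frechetObj
  refine continuousOn_finsetSum _ fun l _ => continuousOn_const.mul (ContinuousOn.pow ?_ 2)
  exact continuousOn_arcosh_one_add.comp (continuousOn_ballQuot (hx l))
    fun y hy => ballQuot_nonneg (hx l) hy

/-- The weights of the quadratic majorant of the Fréchet objective at `y`. -/
noncomputable def majWeight (w : ι → ℝ) (x : ι → E) (y : E) (l : ι) : ℝ :=
  w l * poincG (ballQuot (x l) y) / (1 - ‖x l‖ ^ 2)

theorem majWeight_pos {w : ι → ℝ} {x : ι → E} (hw : ∀ l, 0 < w l) (hx : ∀ l, ‖x l‖ ^ 2 < 1)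
    {y : E} (hy : ‖y‖ ^ 2 < 1) (l : ι) : 0 < majWeight w x y l :=
  div_pos (mul_pos (hw l) (poincG_pos (ballQuot_nonneg (hx l) hy))) (by linarith [hx l])

theorem sum_mul_one_add_pos [Fintype ι] [Nonempty ι] {α : ι → ℝ} {x : ι → E} (hα : ∀ l, 0 < α l) :
    0 < ∑ l, α l * (1 + ‖x l‖ ^ 2) :=
  Finset.sum_pos (fun l _ => mul_pos (hα l) (by positivity)) Finset.univ_nonempty

variable [InnerProductSpace ℝ E]

/-- The image of the hyperbolic tangent vector at `y` pointing to `x`, of length `sinh d(x, y)`,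
under an isometry from the tangent space at `y` to `E`. -/
noncomputable def tangentVec (y x : E) : E :=
  (2 / (1 - ‖x‖ ^ 2)) • (x - y - (‖x - y‖ ^ 2 / (1 - ‖y‖ ^ 2)) • y)

theorem inner_tangentVec {x y z : E} (hx : ‖x‖ ^ 2 < 1) (hy : ‖y‖ ^ 2 < 1) (hz : ‖z‖ ^ 2 < 1) :
    inner ℝ (tangentVec y x) (tangentVec y z) =
      (1 + 2 * ballQuot x y) * (1 + 2 * ballQuot y z) - (1 + 2 * ballQuot x z) := by
  have hx' : 1 - ‖x‖ ^ 2 ≠ 0 := by linarith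
  have hy' : 1 - ‖y‖ ^ 2 ≠ 0 := by linarith
  have hz' : 1 - ‖z‖ ^ 2 ≠ 0 := by linarith
  rw [ballQuot_comm y z]
  simp only [tangentVec, ballQuot, inner_smul_left, inner_smul_right, inner_sub_left,
    inner_sub_right, norm_sub_sq_real, real_inner_self_eq_norm_sq,
    real_inner_comm y z, conj_trivial]
  generalize ‖x‖ ^ 2 = p at *
  generalize ‖y‖ ^ 2 = q at *
  generalize ‖z‖ ^ 2 = r at *
  field_simp
  ring

theorem norm_tangentVec {x y : E} (hx : ‖x‖ ^ 2 < 1) (hy : ‖y‖ ^ 2 < 1) :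
    ‖tangentVec y x‖ = Real.sinh (arcosh (1 + 2 * ballQuot x y)) := by
  have hv := ballQuot_nonneg hx hy
  refine (sq_eq_sq₀ (norm_nonneg _) (Real.sinh_nonneg_iff.2 (arcosh_one_add_nonneg hv))).1 ?_
  rw [← real_inner_self_eq_norm_sq, inner_tangentVec hx hy hx, Real.sinh_sq,
    cosh_arcosh_one_add hv, ballQuot_self, ballQuot_comm y x]
  ring

variable [Fintype ι]

theorem frechetObj_le_of_tangentVec_eq_zero {w : ι → ℝ} {x : ι → E} (hw : ∀ l, 0 < w l)
    (hx : ∀ l, ‖x l‖ ^ 2 < 1) {y z : E} (hy : ‖y‖ ^ 2 < 1) (hz : ‖z‖ ^ 2 < 1)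
    (hcrit : ∑ l, majWeight w x y l • (x l - y - (‖x l - y‖ ^ 2 / (1 - ‖y‖ ^ 2)) • y) = 0) :
    frechetObj w x y ≤ frechetObj w x z := by
  set U := tangentVec y z with hU
  set B := arcosh (1 + 2 * ballQuot y z) with hB
  have hB0 : 0 ≤ B := arcosh_one_add_nonneg (ballQuot_nonneg hy hz)
  have hsum : ∑ l, w l * (2 * inner ℝ (tangentVec y (x l)) U /
      (sinhc (arcosh (1 + 2 * ballQuot (x l) y)) * sinhc B)) = 0 := by
    have h := congrArg (fun v => inner ℝ v U / sinhc B) hcrit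
    simp only [sum_inner, inner_zero_left, zero_div, Finset.sum_div] at h
    rw [← h]
    refine Finset.sum_congr rfl fun l _ => ?_
    have h1 : 1 - ‖x l‖ ^ 2 ≠ 0 := by linarith [hx l]
    have hv := ballQuot_nonneg (hx l) hy
    have h2 := (sinhc_pos (arcosh_one_add_nonneg hv)).ne'
    have h3 := (sinhc_pos hB0).ne'
    rw [majWeight, poincG_eq hv, tangentVec, inner_smul_left, inner_smul_left]
    simp only [conj_trivial]
    field_simp
    ring
  have key : ∀ l, w l * arcosh (1 + 2 * ballQuot (x l) y) ^ 2
      - w l * (2 * inner ℝ (tangentVec y (x l)) U /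
        (sinhc (arcosh (1 + 2 * ballQuot (x l) y)) * sinhc B)) ≤
      w l * arcosh (1 + 2 * ballQuot (x l) z) ^ 2 := by
    intro l
    have hxy := ballQuot_nonneg (hx l) hy
    have h := sq_ge_of_law_of_cosines (C := arcosh (1 + 2 * ballQuot (x l) z))
      (arcosh_one_add_nonneg hxy) hB0
      (norm_tangentVec (hx l) hy) (U := U)
      (by rw [hU, norm_tangentVec hz hy, ballQuot_comm])
      (by
        rw [hU, inner_tangentVec (hx l) hy hz, hB, cosh_arcosh_one_add hxy,
          cosh_arcosh_one_add (ballQuot_nonneg hy hz),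
          cosh_arcosh_one_add (ballQuot_nonneg (hx l) hz)]
        ring)
    rw [← mul_sub]
    exact mul_le_mul_of_nonneg_left (by linarith [sq_nonneg B]) (hw l).le
  have := Finset.sum_le_sum fun l (_ : l ∈ Finset.univ) => key l
  rw [Finset.sum_sub_distrib, hsum, sub_zero] at this
  exact this

/-- The smaller root of `β ^ 2 * η ^ 2 - s * η + 1`, in a form which is regular at `β = 0`. -/
noncomputable def smallRoot (s β : ℝ) : ℝ := 2 / (s + Real.sqrt (s ^ 2 - 4 * β ^ 2))

section SmallRoot

variable {s β : ℝ}

theorem smallRoot_pos (hs : 0 < s) : 0 < smallRoot s β := by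
  unfold smallRoot
  positivity

theorem smallRoot_mul_le_one (hs : 0 < s) (hβ : 2 * β ≤ s) : smallRoot s β * β ≤ 1 := by
  have := Real.sqrt_nonneg (s ^ 2 - 4 * β ^ 2)
  rw [smallRoot, div_mul_eq_mul_div, div_le_one (by positivity)]
  linarith

theorem smallRoot_eq (hs : 0 < s) (hβ0 : 0 ≤ β) (hβ : 2 * β ≤ s) :
    1 + β ^ 2 * smallRoot s β ^ 2 = s * smallRoot s β := by
  have h0 := Real.sqrt_nonneg (s ^ 2 - 4 * β ^ 2)
  have h1 := Real.sq_sqrt (show 0 ≤ s ^ 2 - 4 * β ^ 2 by nlinarith)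
  have h2 : s + Real.sqrt (s ^ 2 - 4 * β ^ 2) ≠ 0 := by positivity
  rw [smallRoot]
  generalize Real.sqrt (s ^ 2 - 4 * β ^ 2) = q at *
  field_simp
  linear_combination h1

theorem smallRoot_eq_sub_sqrt_div (hs : 0 < s) (hβ0 : 0 < β) (hβ : 2 * β ≤ s) :
    smallRoot s β = (s - Real.sqrt (s ^ 2 - 4 * β ^ 2)) / (2 * β ^ 2) := by
  have h0 := Real.sqrt_nonneg (s ^ 2 - 4 * β ^ 2)
  have h1 := Real.sq_sqrt (show 0 ≤ s ^ 2 - 4 * β ^ 2 by nlinarith)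
  rw [smallRoot, div_eq_div_iff (by positivity) (by positivity)]
  linear_combination h1

theorem smallRoot_mul_le {r : ℝ} (hs : 0 < s) (hβ0 : 0 ≤ β) (hβ : 2 * β ≤ s) (hr0 : 0 ≤ r)
    (hr1 : r < 1) (hr : β * r ^ 2 + β ≤ s * r) : smallRoot s β * β ≤ r := by
  have h1 := smallRoot_mul_le_one hs hβ
  have h2 := smallRoot_eq hs hβ0 hβ
  set m := smallRoot s β * β with hm
  have h3 : β * m ^ 2 + β = s * m := by rw [hm]; linear_combination β * h2
  by_contra! hlt
  have h4 : s ≤ β * (m + r) := by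
    by_contra! h
    nlinarith [mul_pos (sub_pos.2 hlt) (sub_pos.2 h)]
  have hmpos : 0 < m := hr0.trans_lt hlt
  have h5 : β * (1 - r * m) ≤ 0 := by nlinarith [mul_le_mul_of_nonneg_right h4 hmpos.le]
  have h6 : 0 < 1 - r * m := by nlinarith
  have h7 : β = 0 := le_antisymm (by by_contra! h; nlinarith [mul_pos h h6]) hβ0
  rw [hm, h7, mul_zero] at hmpos
  exact lt_irrefl _ hmpos

end SmallRoot

/-- The minimizer over the unit ball of `y ↦ ∑ l, α l * ‖x l - y‖ ^ 2 / (1 - ‖y‖ ^ 2)`. -/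
noncomputable def majMin (α : ι → ℝ) (x : ι → E) : E :=
  smallRoot (∑ l, α l * (1 + ‖x l‖ ^ 2)) ‖∑ l, α l • x l‖ • ∑ l, α l • x l

section MajMin

variable {α : ι → ℝ} {x : ι → E}

theorem norm_sum_smul_le (hα : ∀ l, 0 < α l) :
    ‖∑ l, α l • x l‖ ≤ ∑ l, α l * ‖x l‖ := by
  refine (norm_sum_le _ _).trans_eq (Finset.sum_congr rfl fun l _ => ?_)
  rw [norm_smul, Real.norm_of_nonneg (hα l).le]

theorem two_mul_norm_sum_smul_le (hα : ∀ l, 0 < α l) :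
    2 * ‖∑ l, α l • x l‖ ≤ ∑ l, α l * (1 + ‖x l‖ ^ 2) := by
  refine (mul_le_mul_of_nonneg_left (norm_sum_smul_le hα) zero_le_two).trans ?_
  rw [Finset.mul_sum]
  refine Finset.sum_le_sum fun l _ => ?_
  nlinarith [mul_nonneg (hα l).le (sq_nonneg (1 - ‖x l‖))]

theorem norm_majMin_le [Nonempty ι] (hα : ∀ l, 0 < α l) {r : ℝ} (hr : r < 1)
    (hx : ∀ l, ‖x l‖ ≤ r) : ‖majMin α x‖ ≤ r := by
  have hs := sum_mul_one_add_pos (x := x) hα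
  have hr0 : 0 ≤ r := (norm_nonneg _).trans (hx (Classical.arbitrary ι))
  rw [majMin, norm_smul, Real.norm_of_nonneg (smallRoot_pos hs).le]
  refine smallRoot_mul_le hs (norm_nonneg _) (two_mul_norm_sum_smul_le hα) hr0 hr ?_
  calc ‖∑ l, α l • x l‖ * r ^ 2 + ‖∑ l, α l • x l‖ = ‖∑ l, α l • x l‖ * (r ^ 2 + 1) := by ring
    _ ≤ (∑ l, α l * ‖x l‖) * (r ^ 2 + 1) :=
        mul_le_mul_of_nonneg_right (norm_sum_smul_le hα) (by positivity)
    _ ≤ (∑ l, α l * (1 + ‖x l‖ ^ 2)) * r := by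
        rw [Finset.sum_mul, Finset.sum_mul]
        refine Finset.sum_le_sum fun l _ => ?_
        have h : 0 ≤ (1 - ‖x l‖ * r) * (r - ‖x l‖) :=
          mul_nonneg (by nlinarith [hx l, norm_nonneg (x l)]) (sub_nonneg.2 (hx l))
        nlinarith [mul_nonneg (hα l).le h]

theorem majMin_stationary [Nonempty ι] (hα : ∀ l, 0 < α l) :
    (1 - ‖majMin α x‖ ^ 2) • ∑ l, α l • x l =
      (∑ l, α l * (1 + ‖x l‖ ^ 2) - 2 * inner ℝ (∑ l, α l • x l) (majMin α x)) •
        majMin α x := by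
  have hs := sum_mul_one_add_pos (x := x) hα
  have h := smallRoot_eq hs (norm_nonneg _) (two_mul_norm_sum_smul_le (x := x) hα)
  rw [majMin, norm_smul, Real.norm_of_nonneg (smallRoot_pos hs).le, inner_smul_right,
    real_inner_self_eq_norm_sq, smul_smul]
  congr 1
  linear_combination h

theorem sum_mul_norm_sub_sq (α : ι → ℝ) (x : ι → E) (y : E) :
    ∑ l, α l * ‖x l - y‖ ^ 2 = ∑ l, α l * (1 + ‖x l‖ ^ 2) - 2 * inner ℝ (∑ l, α l • x l) y
      - (∑ l, α l) * (1 - ‖y‖ ^ 2) := by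
  simp only [norm_sub_sq_real, sum_inner, inner_smul_left, Finset.mul_sum, Finset.sum_mul,
    ← Finset.sum_sub_distrib, conj_trivial]
  exact Finset.sum_congr rfl fun l _ => by ring

theorem majorant_descent [Nonempty ι] (hα : ∀ l, 0 < α l) {y : E} (hy : ‖y‖ ^ 2 < 1)
    (hm : ‖majMin α x‖ ^ 2 < 1) :
    (∑ l, α l * ‖x l - majMin α x‖ ^ 2) / (1 - ‖majMin α x‖ ^ 2)
      + (∑ l, α l) * ‖y - majMin α x‖ ^ 2 / (1 - ‖y‖ ^ 2) ≤
    (∑ l, α l * ‖x l - y‖ ^ 2) / (1 - ‖y‖ ^ 2) := by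
  have hst := majMin_stationary (x := x) hα
  set z := majMin α x
  have h1 := congrArg (fun v => inner ℝ v z) hst
  have h2 := congrArg (fun v => inner ℝ v y) hst
  simp only [inner_smul_left, conj_trivial, real_inner_self_eq_norm_sq] at h1 h2
  have hy' : 0 < 1 - ‖y‖ ^ 2 := by linarith
  have hz' : 0 < 1 - ‖z‖ ^ 2 := by linarith
  have hnn : 0 ≤ ∑ l, α l * ‖x l - z‖ ^ 2 :=
    Finset.sum_nonneg fun l _ => mul_nonneg (hα l).le (sq_nonneg _)
  have hgap : (∑ l, α l * ‖x l - y‖ ^ 2) / (1 - ‖y‖ ^ 2)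
      - (∑ l, α l * ‖x l - z‖ ^ 2) / (1 - ‖z‖ ^ 2)
      - (∑ l, α l) * ‖y - z‖ ^ 2 / (1 - ‖y‖ ^ 2)
      = (∑ l, α l * ‖x l - z‖ ^ 2) / (1 - ‖z‖ ^ 2) * ‖y - z‖ ^ 2 / (1 - ‖y‖ ^ 2) := by
    rw [sum_mul_norm_sub_sq, sum_mul_norm_sub_sq, norm_sub_sq_real, real_inner_comm z y]
    generalize ‖y‖ ^ 2 = p at *
    generalize ‖z‖ ^ 2 = q at *
    field_simp
    linear_combination 2 * h1 - 2 * h2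
  have : 0 ≤ (∑ l, α l * ‖x l - z‖ ^ 2) / (1 - ‖z‖ ^ 2) * ‖y - z‖ ^ 2 / (1 - ‖y‖ ^ 2) := by
    positivity
  linarith

end MajMin

section Step

variable [Nonempty ι] {w : ι → ℝ} {x : ι → E}

/-- One step of the Fréchet mean iteration in the unit Poincaré ball. -/
noncomputable def meanStep (w : ι → ℝ) (x : ι → E) (y : E) : E := majMin (majWeight w x y) x

theorem frechetObj_meanStep_add_le (hw : ∀ l, 0 < w l) (hx : ∀ l, ‖x l‖ ^ 2 < 1) {y : E}
    (hy : ‖y‖ ^ 2 < 1) (hz : ‖meanStep w x y‖ ^ 2 < 1) :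
    frechetObj w x (meanStep w x y) +
      (∑ l, majWeight w x y l) * ‖y - meanStep w x y‖ ^ 2 / (1 - ‖y‖ ^ 2) ≤
    frechetObj w x y := by
  have hα := majWeight_pos hw hx hy
  have hdesc := majorant_descent (x := x) hα hy hz
  rw [← meanStep] at hdesc
  set z := meanStep w x y
  have hmaj : frechetObj w x z ≤ frechetObj w x y +
      ((∑ l, majWeight w x y l * ‖x l - z‖ ^ 2) / (1 - ‖z‖ ^ 2) -
        (∑ l, majWeight w x y l * ‖x l - y‖ ^ 2) / (1 - ‖y‖ ^ 2)) := by
    rw [frechetObj, frechetObj, Finset.sum_div, Finset.sum_div, ← Finset.sum_sub_distrib,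
      ← Finset.sum_add_distrib]
    refine Finset.sum_le_sum fun l _ => ?_
    have h := mul_le_mul_of_nonneg_left
      (sq_arcosh_le (ballQuot_nonneg (hx l) hz) (ballQuot_nonneg (hx l) hy)) (hw l).le
    refine h.trans_eq ?_
    have h1 : 1 - ‖x l‖ ^ 2 ≠ 0 := by linarith [hx l]
    have h2 : 1 - ‖y‖ ^ 2 ≠ 0 := by linarith
    have h3 : 1 - ‖z‖ ^ 2 ≠ 0 := by linarith
    rw [majWeight]
    generalize poincG (ballQuot (x l) y) = g
    rw [ballQuot, ballQuot]
    field_simp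
  linarith

theorem frechetObj_le_of_meanStep_eq (hw : ∀ l, 0 < w l) (hx : ∀ l, ‖x l‖ ^ 2 < 1) {y z : E}
    (hy : ‖y‖ ^ 2 < 1) (hz : ‖z‖ ^ 2 < 1) (hfix : meanStep w x y = y) :
    frechetObj w x y ≤ frechetObj w x z := by
  have hα := majWeight_pos hw hx hy
  refine frechetObj_le_of_tangentVec_eq_zero hw hx hy hz ?_
  have hst := majMin_stationary (x := x) hα
  rw [← meanStep, hfix] at hst
  have hy' : 1 - ‖y‖ ^ 2 ≠ 0 := by linarith
  have hsum : ∑ l, majWeight w x y l • (x l - y - (‖x l - y‖ ^ 2 / (1 - ‖y‖ ^ 2)) • y) =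
      ∑ l, majWeight w x y l • x l - (∑ l, majWeight w x y l +
        (∑ l, majWeight w x y l * ‖x l - y‖ ^ 2) / (1 - ‖y‖ ^ 2)) • y := by
    rw [add_smul, Finset.sum_div, Finset.sum_smul, Finset.sum_smul, ← Finset.sum_add_distrib,
      ← Finset.sum_sub_distrib]
    refine Finset.sum_congr rfl fun l _ => ?_
    module
  rw [hsum, sub_eq_zero]
  refine smul_right_injective E hy' ?_
  simp only
  rw [hst, smul_smul, sum_mul_norm_sub_sq]
  congr 1
  field_simp
  ring

theorem continuousOn_meanStep (hw : ∀ l, 0 < w l) (hx : ∀ l, ‖x l‖ ^ 2 < 1) :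
    ContinuousOn (meanStep w x) {y | ‖y‖ ^ 2 < 1} := by
  have hα : ∀ l, ContinuousOn (fun y => majWeight w x y l) {y | ‖y‖ ^ 2 < 1} := fun l =>
    (continuousOn_const.mul (continuousOn_poincG.comp (continuousOn_ballQuot (hx l))
      fun y hy => ballQuot_nonneg (hx l) hy)).div_const _
  have hb : ContinuousOn (fun y => ∑ l, majWeight w x y l • x l) {y | ‖y‖ ^ 2 < 1} :=
    continuousOn_finsetSum _ fun l _ => (hα l).smul continuousOn_const
  have hs : ContinuousOn (fun y => ∑ l, majWeight w x y l * (1 + ‖x l‖ ^ 2))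
      {y | ‖y‖ ^ 2 < 1} :=
    continuousOn_finsetSum _ fun l _ => (hα l).mul continuousOn_const
  unfold meanStep majMin smallRoot
  refine ContinuousOn.smul (ContinuousOn.div continuousOn_const
    (hs.add ((hs.pow 2).sub (continuousOn_const.mul (hb.norm.pow 2))).sqrt) ?_) hb
  intro y hy
  have := sum_mul_one_add_pos (x := x) (majWeight_pos hw hx hy)
  positivity

end Step

/-- A descent iteration on a compact set whose objective is stationary only at `p` converges
to `p`. -/
theorem tendsto_of_descent {X : Type*} [TopologicalSpace X] {s : Set X} (hs : IsCompact s)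
    {Φ : X → X} {f : X → ℝ} (hΦ : ContinuousOn Φ s) (hmaps : Set.MapsTo Φ s s)
    (hf : ContinuousOn f s) (hle : ∀ y ∈ s, f (Φ y) ≤ f y) {p : X}
    (heq : ∀ y ∈ s, f (Φ y) = f y → y = p) {u : ℕ → X} (hmem : ∀ k, u k ∈ s)
    (hu : ∀ k, u (k + 1) = Φ (u k)) : Tendsto u atTop (nhds p) := by
  have hanti : Antitone (f ∘ u) := antitone_nat_of_succ_le fun k => by
    simpa [hu] using hle _ (hmem k)
  have hbdd : BddBelow (Set.range (f ∘ u)) :=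
    (hs.image_of_continuousOn hf).bddBelow.mono (by
      rintro _ ⟨k, rfl⟩
      exact ⟨u k, hmem k, rfl⟩)
  have hlim := tendsto_atTop_ciInf hanti hbdd
  have hlim' := hlim.comp (tendsto_add_atTop_nat 1)
  refine hs.tendsto_nhds_of_unique_mapClusterPt (Eventually.of_forall hmem) fun q hq hcl => ?_
  obtain ⟨U, hU, hUq⟩ := mapClusterPt_iff_ultrafilter.1 hcl
  have hUq' : Tendsto u U (nhdsWithin q s) :=
    tendsto_nhdsWithin_iff.2 ⟨hUq, Eventually.of_forall hmem⟩
  have hΦq : Tendsto (Φ ∘ u) U (nhdsWithin (Φ q) s) :=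
    tendsto_nhdsWithin_iff.2 ⟨(hΦ q hq).tendsto.comp hUq',
      Eventually.of_forall fun k => hmaps (hmem k)⟩
  have h1 := tendsto_nhds_unique ((hf q hq).tendsto.comp hUq') (hlim.mono_left hU)
  have h2 : Tendsto (f ∘ (Φ ∘ u)) U (nhds (f (Φ q))) := (hf _ (hmaps hq)).tendsto.comp hΦq
  have h3 : f ∘ (Φ ∘ u) = (f ∘ u) ∘ fun k => k + 1 := by
    ext k
    simp [hu]
  rw [h3] at h2
  exact heq q hq ((tendsto_nhds_unique h2 (hlim'.mono_left hU)).trans h1.symm)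

section Convergence

variable [Nonempty ι] {w : ι → ℝ} {x : ι → E} {r : ℝ}

theorem norm_meanStep_le (hw : ∀ l, 0 < w l) (hr : r < 1) (hx : ∀ l, ‖x l‖ ≤ r) {y : E}
    (hy : ‖y‖ ≤ r) : ‖meanStep w x y‖ ≤ r :=
  norm_majMin_le (majWeight_pos hw (fun l => norm_sq_lt_one hr (hx l)) (norm_sq_lt_one hr hy))
    hr hx

theorem tendsto_meanStep [ProperSpace E] (hw : ∀ l, 0 < w l) (hr : r < 1) (hx : ∀ l, ‖x l‖ ≤ r)
    {p : E} (hp : ‖p‖ ^ 2 < 1)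
    (hmin : ∀ z : E, ‖z‖ ^ 2 < 1 → frechetObj w x z ≤ frechetObj w x p → z = p)
    {u : ℕ → E} (hmem : ∀ k, ‖u k‖ ≤ r) (hu : ∀ k, u (k + 1) = meanStep w x (u k)) :
    Tendsto u atTop (nhds p) := by
  have hx' : ∀ l, ‖x l‖ ^ 2 < 1 := fun l => norm_sq_lt_one hr (hx l)
  have hball : ∀ y ∈ Metric.closedBall (0 : E) r, ‖y‖ ^ 2 < 1 := fun y hy =>
    norm_sq_lt_one hr (mem_closedBall_zero_iff.1 hy)
  have hmaps : Set.MapsTo (meanStep w x) (Metric.closedBall 0 r) (Metric.closedBall 0 r) :=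
    fun y hy => mem_closedBall_zero_iff.2
      (norm_meanStep_le hw hr hx (mem_closedBall_zero_iff.1 hy))
  have hdesc := fun y hy => frechetObj_meanStep_add_le hw hx' (hball y hy) (hball _ (hmaps hy))
  have hα : ∀ y ∈ Metric.closedBall (0 : E) r, 0 < ∑ l, majWeight w x y l := fun y hy =>
    Finset.sum_pos (fun l _ => majWeight_pos hw hx' (hball y hy) l) Finset.univ_nonempty
  have hden : ∀ y ∈ Metric.closedBall (0 : E) r, 0 < 1 - ‖y‖ ^ 2 := fun y hy =>
    sub_pos.2 (hball y hy)
  refine tendsto_of_descent (isCompact_closedBall (0 : E) r)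
    ((continuousOn_meanStep hw hx').mono hball) hmaps ((continuousOn_frechetObj w hx').mono hball)
    (fun y hy => ?_) (fun y hy heq => hmin y (hball y hy) ?_)
    (fun k => mem_closedBall_zero_iff.2 (hmem k)) hu
  · have h1 := hα y hy
    have h2 := hden y hy
    exact (le_add_of_nonneg_right (by positivity)).trans (hdesc y hy)
  · refine frechetObj_le_of_meanStep_eq hw hx' (hball y hy) hp ?_
    by_contra hne
    have h1 := hα y hy
    have h2 := hden y hy
    have h3 : 0 < ‖y - meanStep w x y‖ := norm_pos_iff.2 (sub_ne_zero.2 (Ne.symm hne))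
    have h4 : 0 < (∑ l, majWeight w x y l) * ‖y - meanStep w x y‖ ^ 2 / (1 - ‖y‖ ^ 2) := by
      positivity
    linarith [hdesc y hy]

end Convergence

theorem norm_smul_sq_of_sq_eq {ρ κ : ℝ} (hρ : ρ ^ 2 = κ) (y : E) :
    ‖ρ • y‖ ^ 2 = κ * ‖y‖ ^ 2 := by
  rw [norm_smul, mul_pow, Real.norm_eq_abs, sq_abs, hρ]

theorem ballQuot_smul {ρ κ : ℝ} (hρ : ρ ^ 2 = κ) (x y : E) :
    ballQuot (ρ • x) (ρ • y) =
      κ * ‖x - y‖ ^ 2 / ((1 - κ * ‖x‖ ^ 2) * (1 - κ * ‖y‖ ^ 2)) := by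
  rw [ballQuot, ← smul_sub, norm_smul_sq_of_sq_eq hρ, norm_smul_sq_of_sq_eq hρ,
    norm_smul_sq_of_sq_eq hρ]

/-- The minimizer of the majorant in rescaled coordinates, through the quadratic formula. -/
theorem majMin_smul [Nonempty ι] {ρ κ : ℝ} (hρ : ρ ^ 2 = κ) (hκ : 0 < κ) {α : ι → ℝ}
    {x : ι → E} (hα : ∀ l, 0 < α l) {a c : ℝ} {b : E} [Decidable (b = 0)]
    (ha : a = ∑ l, α l) (hb : b = ∑ l, α l • x l)
    (hc : c = ∑ l, α l * ‖x l‖ ^ 2) :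
    majMin α (fun l => ρ • x l) = ρ • (if b = 0 then 0 else
      (((a + c * κ) - Real.sqrt ((a + c * κ) ^ 2 - 4 * κ * ‖b‖ ^ 2)) / (2 * κ * ‖b‖ ^ 2)) • b) := by
  have hs := sum_mul_one_add_pos (x := fun l => ρ • x l) hα
  have hle := two_mul_norm_sum_smul_le (x := fun l => ρ • x l) hα
  have hsum : ∑ l, α l • ρ • x l = ρ • b := by
    simp only [hb, Finset.smul_sum, smul_comm ρ]
  have hs_eq : ∑ l, α l * (1 + ‖ρ • x l‖ ^ 2) = a + c * κ := by
    simp only [ha, hc, norm_smul_sq_of_sq_eq hρ, Finset.sum_mul, ← Finset.sum_add_distrib]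
    exact Finset.sum_congr rfl fun l _ => by ring
  rw [hs_eq] at hs
  rw [hs_eq, hsum] at hle
  rw [majMin, hs_eq, hsum]
  split_ifs with h
  · simp [h]
  · have hρ0 : ρ ≠ 0 := by
      rintro rfl
      norm_num at hρ
      exact hκ.ne hρ
    rw [smallRoot_eq_sub_sqrt_div hs (norm_pos_iff.2 (smul_ne_zero hρ0 h)) hle,
      norm_smul_sq_of_sq_eq hρ, smul_comm]
    simp only [mul_assoc]

end PoincareFrechetMean

open PoincareFrechetMean

/-- convergence of the Poincaré-ball Fréchet mean algorithm. Starting at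
`y 0 = x⁽¹⁾`, with `α l = w l * G(v_l) / (1 − |K|‖x⁽ˡ⁾‖²)`,
`a = ∑ α l`, `b = ∑ α l • x⁽ˡ⁾`, `c = ∑ α l ‖x⁽ˡ⁾‖²`, and update `y_{k+1} = η • b`,
all iterates stay in the ball `D = {y : |K|‖y‖² < 1}` and the sequence converges to the
unique minimizer `μ` of the Fréchet objective over `D`. -/

theorem poincare_frechet_mean_algorithm_converges
    (n t : ℕ) (ht : 0 < t) (K : ℝ) (hK : K < 0)
    (x : Fin t → EuclideanSpace ℝ (Fin n))
    (hx : ∀ l, |K| * ‖x l‖ ^ 2 < 1)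
    (w : Fin t → ℝ) (hw : ∀ l, 0 < w l)
    (f : EuclideanSpace ℝ (Fin n) → ℝ)
    (hf : ∀ y, f y = ∑ l, (w l / |K|) *
      (arcosh (1 + 2 * (|K| * ‖x l - y‖ ^ 2 /
        ((1 - |K| * ‖x l‖ ^ 2) * (1 - |K| * ‖y‖ ^ 2))))) ^ 2)
    (μ : EuclideanSpace ℝ (Fin n)) (hμD : |K| * ‖μ‖ ^ 2 < 1)
    (hμmin : ∀ z : EuclideanSpace ℝ (Fin n), |K| * ‖z‖ ^ 2 < 1 → f μ ≤ f z)
    (hμuniq : ∀ z : EuclideanSpace ℝ (Fin n), |K| * ‖z‖ ^ 2 < 1 → f z = f μ → z = μ)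
    (y : ℕ → EuclideanSpace ℝ (Fin n)) (hy0 : y 0 = x ⟨0, ht⟩)
    (α : ℕ → Fin t → ℝ)
    (hα : ∀ k l, α k l = w l * poincG (|K| * ‖x l - y k‖ ^ 2 /
      ((1 - |K| * ‖x l‖ ^ 2) * (1 - |K| * ‖y k‖ ^ 2))) / (1 - |K| * ‖x l‖ ^ 2))
    (a c : ℕ → ℝ) (b : ℕ → EuclideanSpace ℝ (Fin n))
    (ha : ∀ k, a k = ∑ l, α k l)
    (hb : ∀ k, b k = ∑ l, α k l • x l)
    (hc : ∀ k, c k = ∑ l, α k l * ‖x l‖ ^ 2)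
    (hy : ∀ k, y (k + 1) = if b k = 0 then 0 else
      (((a k + c k * |K|) -
          Real.sqrt ((a k + c k * |K|) ^ 2 - 4 * |K| * ‖b k‖ ^ 2)) /
        (2 * |K| * ‖b k‖ ^ 2)) • b k) :
    (∀ k, |K| * ‖y k‖ ^ 2 < 1) ∧ Tendsto y atTop (nhds μ) := by
  have : Nonempty (Fin t) := ⟨⟨0, ht⟩⟩
  have hκ : 0 < |K| := abs_pos.2 hK.ne
  generalize |K| = κ at *
  obtain ⟨ρ, hρ0, hρ⟩ : ∃ ρ : ℝ, 0 < ρ ∧ ρ ^ 2 = κ :=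
    ⟨Real.sqrt κ, Real.sqrt_pos.2 hκ, Real.sq_sqrt hκ.le⟩
  have hnorm : ∀ z : EuclideanSpace ℝ (Fin n), ‖ρ • z‖ ^ 2 = κ * ‖z‖ ^ 2 :=
    norm_smul_sq_of_sq_eq hρ
  obtain ⟨m, hm⟩ := Finite.exists_max fun l => ‖ρ • x l‖
  have hr : ‖ρ • x m‖ < 1 := by
    rw [← sq_lt_one_iff₀ (norm_nonneg _), hnorm]
    exact hx m
  have hball : ∀ {z : EuclideanSpace ℝ (Fin n)}, ‖ρ • z‖ ≤ ‖ρ • x m‖ → κ * ‖z‖ ^ 2 < 1 :=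
    fun hz => hnorm _ ▸ norm_sq_lt_one hr hz
  have hstep : ∀ k, ‖ρ • y k‖ ≤ ‖ρ • x m‖ →
      ρ • y (k + 1) = meanStep w (fun l => ρ • x l) (ρ • y k) := by
    intro k hk
    have hα' : α k = majWeight w (fun l => ρ • x l) (ρ • y k) := by
      ext l
      rw [hα, majWeight, ballQuot_smul hρ, hnorm]
    have hpos : ∀ l, 0 < α k l := fun l => by
      rw [hα']
      exact majWeight_pos hw (fun l => norm_sq_lt_one hr (hm l)) (norm_sq_lt_one hr hk) l
    rw [meanStep, ← hα', majMin_smul hρ hκ hpos (ha k) (hb k) (hc k), hy]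
  have hmem : ∀ k, ‖ρ • y k‖ ≤ ‖ρ • x m‖ := by
    intro k
    induction k with
    | zero => rw [hy0]; exact hm _
    | succ k ih => rw [hstep k ih]; exact norm_meanStep_le hw hr hm ih
  refine ⟨fun k => hball (hmem k), ?_⟩
  have hobj : ∀ z, frechetObj w (fun l => ρ • x l) (ρ • z) = κ * f z := by
    intro z
    rw [frechetObj, hf, Finset.mul_sum]
    refine Finset.sum_congr rfl fun l _ => ?_
    rw [ballQuot_smul hρ]
    field_simp
  have hlim : Tendsto (fun k => ρ • y k) atTop (nhds (ρ • μ)) := by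
    refine tendsto_meanStep hw hr hm (by rwa [hnorm]) (fun z hz hle => ?_) hmem
      fun k => hstep k (hmem k)
    obtain ⟨z, rfl⟩ : ∃ z', z = ρ • z' := ⟨ρ⁻¹ • z, (smul_inv_smul₀ hρ0.ne' z).symm⟩
    rw [hnorm] at hz
    rw [hobj, hobj] at hle
    rw [hμuniq z hz (le_antisymm (le_of_mul_le_mul_left hle hκ) (hμmin z hz))]
  simpa [smul_smul, hρ0.ne'] using hlim.const_smul ρ⁻¹
end

section
/- Let K < 0, let α₁, …, α_t > 0, and let x⁽¹⁾, …, x⁽ᵗ⁾ ∈ ℝⁿ satisfy |K|·‖x⁽ˡ⁾‖² < 1 for every l. Set a = Σ_{l=1}^t α_l, b = Σ_{l=1}^t α_l·x⁽ˡ⁾ and c = Σ_{l=1}^t α_l·‖x⁽ˡ⁾‖², and assume b ≠ 0. Then (a + c·|K|)² ≥ 4·|K|·‖b‖², the point y* = η·b with η = ((a + c·|K|) − √((a + c·|K|)² − 4·|K|·‖b‖²)) / (2·|K|·‖b‖²) satisfies |K|·‖y*‖² < 1, and y* minimizes the function F(y) = (a·‖y‖² − 2·⟨b, y⟩ + c)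 / (1 − |K|·‖y‖²) over the open ball { y ∈ ℝⁿ : |K|·‖y‖² < 1 }; that is, F(y*) ≤ F(y) for every y with |K|·‖y‖² < 1. -/
open scoped RealInnerProductSpace

/-- A positively weighted combination of points of the ball `{x | k‖x‖² < 1}` has norm controlled
by the weighted sum of `1 + k‖x‖²`. -/
theorem two_sqrt_mul_norm_sum_lt {E ι : Type*} [NormedAddCommGroup E] [NormedSpace ℝ E]
    {s : Finset ι} (hs : s.Nonempty) {k : ℝ} (hk : 0 < k) {α : ι → ℝ} {x : ι → E}
    (hα : ∀ l ∈ s, 0 < α l) (hx : ∀ l ∈ s, k * ‖x l‖ ^ 2 < 1) :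
    2 * √k * ‖∑ l ∈ s, α l • x l‖ < ∑ l ∈ s, α l + (∑ l ∈ s, α l * ‖x l‖ ^ 2) * k := by
  have hsq : √k ^ 2 = k := Real.sq_sqrt hk.le
  calc 2 * √k * ‖∑ l ∈ s, α l • x l‖
      ≤ 2 * √k * ∑ l ∈ s, ‖α l • x l‖ := by gcongr; exact norm_sum_le _ _
    _ = ∑ l ∈ s, α l * (2 * (√k * ‖x l‖)) := by
      rw [Finset.mul_sum]
      refine Finset.sum_congr rfl fun l hl => ?_
      rw [norm_smul, Real.norm_of_nonneg (hα l hl).le]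
      ring
    _ < ∑ l ∈ s, α l * (1 + k * ‖x l‖ ^ 2) := by
      refine Finset.sum_lt_sum_of_nonempty hs fun l hl => mul_lt_mul_of_pos_left ?_ (hα l hl)
      have hlt : (√k * ‖x l‖) ^ 2 < 1 := by rw [mul_pow, hsq]; exact hx l hl
      have hone : √k * ‖x l‖ < 1 := by nlinarith
      have hgap : 0 < (1 - √k * ‖x l‖) ^ 2 := pow_pos (sub_pos.2 hone) 2
      have hexp : k * ‖x l‖ ^ 2 = (√k * ‖x l‖) ^ 2 := by rw [mul_pow, hsq]
      rw [hexp]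
      linarith
    _ = ∑ l ∈ s, α l + (∑ l ∈ s, α l * ‖x l‖ ^ 2) * k := by
      rw [Finset.sum_mul, ← Finset.sum_add_distrib]
      exact Finset.sum_congr rfl fun l _ => by ring

/-- The smaller root of `q η² - S η + 1`, for positive `q` and `S` with positive discriminant. -/
theorem quadratic_smaller_root {q S η : ℝ} (hq : 0 < q) (hS : 0 < S) (hD : 4 * q < S ^ 2)
    (hη : η = (S - √(S ^ 2 - 4 * q)) / (2 * q)) :
    0 < η ∧ q * η ^ 2 - S * η + 1 = 0 ∧ q * η ^ 2 < 1 := by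
  set p := √(S ^ 2 - 4 * q) with hp
  have hp_pos : 0 < p := Real.sqrt_pos.2 (by linarith)
  have hp_sq : p ^ 2 = S ^ 2 - 4 * q := Real.sq_sqrt (by linarith)
  have hpS : p < S := by nlinarith
  have hmul : 2 * (q * η) = S - p := by rw [hη]; field_simp
  have hη_pos : 0 < η := by rw [hη]; exact div_pos (by linarith) (by linarith)
  have hroot : q * η ^ 2 - S * η + 1 = 0 := by
    have h : 4 * q * (q * η ^ 2 - S * η + 1) = 0 := by
      linear_combination (2 * (q * η) - S - p) * hmul + hp_sq
    exact (mul_eq_zero.1 h).resolve_left (by positivity)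
  refine ⟨hη_pos, hroot, ?_⟩
  have : (S + p) * η = 2 := by linear_combination η * hmul - 2 * hroot
  nlinarith [mul_pos hp_pos hη_pos]

/-- If `η` solves the critical point equation, the surrogate exceeds the constant `(η⁻¹ - a) / k`
by a multiple of `‖y - η • b‖²`. -/
theorem surrogate_eq_add {E : Type*} [NormedAddCommGroup E] [InnerProductSpace ℝ E]
    {a c k η : ℝ} {b y : E} (hk : k ≠ 0) (hη : η ≠ 0)
    (hroot : k * ‖b‖ ^ 2 * η ^ 2 - (a + c * k) * η + 1 = 0) (hy : 1 - k * ‖y‖ ^ 2 ≠ 0) :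
    (a * ‖y‖ ^ 2 - 2 * ⟪b, y⟫ + c) / (1 - k * ‖y‖ ^ 2) =
      (η⁻¹ - a) / k + ‖y - η • b‖ ^ 2 / (η * (1 - k * ‖y‖ ^ 2)) := by
  rw [norm_sub_sq_real, inner_smul_right, norm_smul, mul_pow, Real.norm_eq_abs, sq_abs,
    real_inner_comm b y]
  generalize hd : 1 - k * ‖y‖ ^ 2 = d at hy ⊢
  field_simp
  linear_combination (1 - a * η) * hd - hroot

/-- the closed-form minimizer of the quadratic-over-quadratic surrogate
objective `F(y) = (a‖y‖² − 2⟨b,y⟩ + c)/(1 − |K|‖y‖²)` over the Poincaré ball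
`{y : |K|‖y‖² < 1}` is `y* = η • b` with
`η = ((a + c|K|) − √((a + c|K|)² − 4|K|‖b‖²)) / (2|K|‖b‖²)`; moreover the discriminant is
nonnegative and `y*` lies in the ball. -/
theorem poincare_surrogate_minimizer
    (n t : ℕ) (K : ℝ) (hK : K < 0)
    (α : Fin t → ℝ) (hα : ∀ l, 0 < α l)
    (x : Fin t → EuclideanSpace ℝ (Fin n))
    (hx : ∀ l, |K| * ‖x l‖ ^ 2 < 1)
    (a c : ℝ) (b : EuclideanSpace ℝ (Fin n))
    (ha : a = ∑ l, α l)
    (hb : b = ∑ l, α l • x l)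
    (hc : c = ∑ l, α l * ‖x l‖ ^ 2)
    (hbne : b ≠ 0)
    (η : ℝ)
    (hη : η = ((a + c * |K|) -
        Real.sqrt ((a + c * |K|) ^ 2 - 4 * |K| * ‖b‖ ^ 2)) / (2 * |K| * ‖b‖ ^ 2))
    (ystar : EuclideanSpace ℝ (Fin n)) (hystar : ystar = η • b) :
    4 * |K| * ‖b‖ ^ 2 ≤ (a + c * |K|) ^ 2 ∧
    |K| * ‖ystar‖ ^ 2 < 1 ∧
    ∀ y : EuclideanSpace ℝ (Fin n), |K| * ‖y‖ ^ 2 < 1 →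
      (a * ‖ystar‖ ^ 2 - 2 * ⟪b, ystar⟫ + c) / (1 - |K| * ‖ystar‖ ^ 2) ≤
      (a * ‖y‖ ^ 2 - 2 * ⟪b, y⟫ + c) / (1 - |K| * ‖y‖ ^ 2) := by
  have hk : 0 < |K| := abs_pos.2 hK.ne
  have hne : (Finset.univ : Finset (Fin t)).Nonempty := by
    refine Finset.nonempty_iff_ne_empty.2 fun h => hbne ?_
    rw [hb, h, Finset.sum_empty]
  have hlt : 2 * √|K| * ‖b‖ < a + c * |K| := by
    rw [ha, hb, hc]
    exact two_sqrt_mul_norm_sum_lt hne hk (fun l _ => hα l) (fun l _ => hx l)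
  have hnonneg : 0 ≤ 2 * √|K| * ‖b‖ := by positivity
  have hD : 4 * (|K| * ‖b‖ ^ 2) < (a + c * |K|) ^ 2 := by
    calc 4 * (|K| * ‖b‖ ^ 2) = (2 * √|K| * ‖b‖) ^ 2 := by
          rw [mul_pow, mul_pow, Real.sq_sqrt hk.le]; ring
      _ < (a + c * |K|) ^ 2 := pow_lt_pow_left₀ hlt hnonneg two_ne_zero
  have hq : 0 < |K| * ‖b‖ ^ 2 := mul_pos hk (pow_pos (norm_pos_iff.2 hbne) 2)
  obtain ⟨hη_pos, hroot, hball⟩ := quadratic_smaller_root hq (hnonneg.trans_lt hlt) hD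
    (by rw [hη, mul_assoc 4, mul_assoc 2] : η = _)
  have hstar : |K| * ‖ystar‖ ^ 2 < 1 := by
    rw [hystar, norm_smul, mul_pow, Real.norm_eq_abs, sq_abs]
    linarith
  refine ⟨by linarith, hstar, fun y hy => ?_⟩
  have hy_pos : 0 < 1 - |K| * ‖y‖ ^ 2 := sub_pos.2 hy
  rw [surrogate_eq_add hk.ne' hη_pos.ne' hroot (sub_pos.2 hstar).ne',
    surrogate_eq_add hk.ne' hη_pos.ne' hroot hy_pos.ne', hystar, sub_self, norm_zero,
    zero_pow two_ne_zero, zero_div, add_zero]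
  exact le_add_of_nonneg_right (by positivity)
end

section
/- Let K < 0, let α₁, …, α_t > 0, let x⁽¹⁾, …, x⁽ᵗ⁾ ∈ ℝⁿ with |K|·‖x⁽ˡ⁾‖² < 1 for all l, and let w₁, …, w_t > 0 with each α_l = w_l·G(v_l(y))/(1 − |K|·‖x⁽ˡ⁾‖²) computed at a point y in the open ball D = { y : |K|·‖y‖² < 1 }, where v_l(y) = |K|·‖x⁽ˡ⁾ − y‖² / ((1 − |K|·‖x⁽ˡ⁾‖²)(1 − |K|·‖y‖²)), G(v) = 2·arcosh(1 + 2v)/√(v² + v) for v > 0 and G(0) = 4. Let y⁺ denote the Poincaré algorithm update: y⁺ = η·b with a = Σα_l, b = Σα_l·x⁽ˡ⁾, c = Σα_l·‖x⁽ˡ⁾‖², η = ((a + c·|K|) − √((a + c·|K|)² − 4·|K|·‖b‖²)) / (2·|K|·‖b‖²) if b ≠ 0, and y⁺ = 0 if b = 0. Let f(y) = Σ_{l=1}^t (w_l/|K|)·arcosh(1 + 2·v_l(y))². Then f(y⁺) ≤ f(y), and if y is not a minimizer of f over D then f(y⁺) < f(y). -/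
open scoped Classical

open Real in
theorem mul_sinh_le_mul_sinh_s14 {r s : ℝ} (hr : 0 ≤ r) (hrs : r ≤ s) :
    s * sinh r ≤ r * sinh s := by
  have hconv : ConvexOn ℝ (Set.Ici 0) sinh := by
    refine convexOn_of_deriv2_nonneg (convex_Ici 0) continuous_sinh.continuousOn
      differentiable_sinh.differentiableOn (by simpa using differentiable_cosh.differentiableOn) ?_
    intro u hu
    rw [interior_Ici] at hu
    simpa using (sinh_pos_iff.2 hu).le
  rcases (hr.trans hrs).eq_or_lt with rfl | hs
  · obtain rfl : r = 0 := le_antisymm hrs hr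
    simp
  have h := hconv.2 (Set.mem_Ici.2 le_rfl) (Set.mem_Ici.2 hs.le)
    (sub_nonneg.2 ((div_le_one hs).2 hrs)) (div_nonneg hr hs.le) (sub_add_cancel 1 (r / s))
  simp only [smul_eq_mul, mul_zero, zero_add, sinh_zero, div_mul_cancel₀ r hs.ne'] at h
  rw [div_mul_eq_mul_div, le_div_iff₀ hs] at h
  linarith

open Real in
/-- The tangent-line inequality for `cosh ∘ √`, with denominators cleared. -/
theorem sq_sub_sq_mul_sinh_le {r s : ℝ} (hr : 0 ≤ r) (hs : 0 ≤ s) :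
    (r ^ 2 - s ^ 2) * sinh s ≤ 2 * s * (cosh r - cosh s) := by
  set φ : ℝ → ℝ := fun r => 2 * s * (cosh r - cosh s) - (r ^ 2 - s ^ 2) * sinh s with hφ
  have hd : ∀ u, HasDerivAt φ (2 * s * sinh u - 2 * u * sinh s) u := by
    intro u
    have h := (((hasDerivAt_cosh u).sub_const (cosh s)).const_mul (2 * s)).sub
      ((((hasDerivAt_id u).pow 2).sub_const (s ^ 2)).mul_const (sinh s))
    refine h.congr_deriv ?_
    simp
  have hc : Continuous φ := continuous_iff_continuousAt.2 fun u => (hd u).continuousAt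
  have hφs : φ s = 0 := by simp [hφ]
  have key : φ s ≤ φ r := by
    rcases le_total r s with hrs | hrs
    · refine antitoneOn_of_deriv_nonpos (convex_Icc 0 s) hc.continuousOn
        (fun u _ => (hd u).differentiableAt.differentiableWithinAt) ?_ ⟨hr, hrs⟩ ⟨hs, le_rfl⟩ hrs
      intro u hu
      rw [interior_Icc] at hu
      rw [(hd u).deriv]
      linarith [mul_sinh_le_mul_sinh_s14 hu.1.le hu.2.le]
    · refine monotoneOn_of_deriv_nonneg (convex_Ici s) hc.continuousOn
        (fun u _ => (hd u).differentiableAt.differentiableWithinAt) ?_ Set.self_mem_Ici hrs hrs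
      intro u hu
      rw [interior_Ici] at hu
      rw [(hd u).deriv]
      linarith [mul_sinh_le_mul_sinh_s14 hs (le_of_lt hu)]
  rw [hφs] at key
  simp only [hφ] at key
  linarith

open Real in
theorem sq_le_two_mul_cosh_sub_one (r : ℝ) : r ^ 2 ≤ 2 * (cosh r - 1) := by
  have h := cosh_sq (r / 2)
  have h2 := cosh_two_mul (r / 2)
  rw [mul_div_cancel₀ r two_ne_zero] at h2
  have h3 : |r / 2| ≤ |sinh (r / 2)| := by
    rw [abs_sinh]
    exact self_le_sinh_iff.2 (abs_nonneg _)
  have h4 := sq_le_sq.2 h3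
  nlinarith

theorem arcosh_one_add_nonneg {v : ℝ} (hv : 0 ≤ v) : 0 ≤ arcosh (1 + 2 * v) :=
  Real.arcosh_nonneg (by linarith)

theorem cosh_arcosh_one_add {v : ℝ} (hv : 0 ≤ v) :
    Real.cosh (arcosh (1 + 2 * v)) = 1 + 2 * v :=
  Real.cosh_arcosh (by linarith)

theorem arcosh_one_add_pos {v : ℝ} (hv : 0 < v) : 0 < arcosh (1 + 2 * v) :=
  Real.arcosh_pos (by linarith)

theorem poincG_eq {v : ℝ} (hv : 0 < v) :
    poincG v = 4 * arcosh (1 + 2 * v) / Real.sinh (arcosh (1 + 2 * v)) := by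
  have h : Real.sinh (arcosh (1 + 2 * v)) = 2 * Real.sqrt (v ^ 2 + v) := by
    refine (Real.sinh_arcosh (by linarith)).trans ?_
    rw [show (1 + 2 * v) ^ 2 - 1 = 2 ^ 2 * (v ^ 2 + v) by ring,
      Real.sqrt_mul (by positivity), Real.sqrt_sq (by norm_num)]
  have hpos : 0 < Real.sqrt (v ^ 2 + v) := Real.sqrt_pos.2 (by positivity)
  rw [h, poincG, if_neg hv.not_ge]
  field_simp
  ring

theorem poincG_pos (v : ℝ) : 0 < poincG v := by
  rcases le_or_gt v 0 with hv | hv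
  · simp [poincG, hv]
  · rw [poincG_eq hv]
    have h := arcosh_one_add_pos hv
    have := Real.sinh_pos_iff.2 h
    positivity

/-- `poincG v` is a supergradient at `v` of the concave function `v ↦ arcosh (1 + 2v) ^ 2`,
evaluated at `(cosh r - 1) / 2`. -/
theorem sq_le_arcosh_sq_add (r : ℝ) {v : ℝ} (hv : 0 ≤ v) :
    r ^ 2 ≤ arcosh (1 + 2 * v) ^ 2 + poincG v / 2 * (Real.cosh r - (1 + 2 * v)) := by
  rcases hv.eq_or_lt with rfl | hv
  · have h0 : arcosh (1 + 2 * 0) = 0 := by simp [arcosh]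
    rw [h0]
    simp only [poincG, le_refl, if_true]
    linarith [sq_le_two_mul_cosh_sub_one r]
  · have hA := arcosh_one_add_pos hv
    have h := sq_sub_sq_mul_sinh_le (abs_nonneg r) hA.le
    have hS := Real.sinh_pos_iff.2 hA
    rw [Real.cosh_abs, sq_abs, cosh_arcosh_one_add hv.le, ← le_div_iff₀ hS] at h
    rw [poincG_eq hv]
    calc r ^ 2 ≤ arcosh (1 + 2 * v) ^ 2 + 2 * arcosh (1 + 2 * v) *
          (Real.cosh r - (1 + 2 * v)) / Real.sinh (arcosh (1 + 2 * v)) := by linarith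
      _ = _ := by ring

/-- The hyperbolic comparison inequality: if `p = cosh A`, `r = cosh B`, `s = cosh C` for the sides
of a hyperbolic triangle, then `C² ≥ A² + B² - 2AB cos γ`, where `γ` is the angle opposite `C`. -/
theorem arcosh_sq_add_le {p r s : ℝ} (hp : 0 ≤ p) (hr : 0 < r) (hs : 0 ≤ s)
    (h : ((1 + 2 * p) * (1 + 2 * r) - (1 + 2 * s)) ^ 2 ≤
      ((1 + 2 * p) ^ 2 - 1) * ((1 + 2 * r) ^ 2 - 1)) :
    arcosh (1 + 2 * p) ^ 2 + arcosh (1 + 2 * r) ^ 2 -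
      arcosh (1 + 2 * r) / (2 * Real.sinh (arcosh (1 + 2 * r))) *
        (poincG p * ((1 + 2 * p) * (1 + 2 * r) - (1 + 2 * s))) ≤ arcosh (1 + 2 * s) ^ 2 := by
  rcases hp.eq_or_lt with rfl | hp
  · have h0 : arcosh (1 + 2 * 0) = 0 := by simp [arcosh]
    obtain rfl : r = s := by nlinarith
    rw [h0]
    simp
  have hcA := cosh_arcosh_one_add hp.le
  have hcB := cosh_arcosh_one_add hr.le
  have hSA := Real.sinh_pos_iff.2 (arcosh_one_add_pos hp)
  have hSB := Real.sinh_pos_iff.2 (arcosh_one_add_pos hr)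
  rw [poincG_eq hp]
  set A := arcosh (1 + 2 * p)
  set B := arcosh (1 + 2 * r)
  rw [← hcA, ← hcB] at h ⊢
  have hA2 := Real.cosh_sq A
  have hB2 := Real.cosh_sq B
  obtain ⟨τ, hτ⟩ : ∃ τ, τ = (Real.cosh A * Real.cosh B - (1 + 2 * s)) /
    (Real.sinh A * Real.sinh B) := ⟨_, rfl⟩
  have hτ' : Real.cosh A * Real.cosh B - (1 + 2 * s) = τ * (Real.sinh A * Real.sinh B) := by
    rw [hτ]; field_simp
  have hτ1 : τ ^ 2 ≤ 1 := by
    have hpos : 0 < (Real.sinh A * Real.sinh B) ^ 2 := by positivity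
    rw [hτ', hA2, hB2] at h
    refine le_of_mul_le_mul_right (?_ : _ ≤ 1 * (Real.sinh A * Real.sinh B) ^ 2) hpos
    linarith
  obtain ⟨hτ2, hτ3⟩ := abs_le.1 ((sq_le_one_iff_abs_le_one τ).1 hτ1)
  have h1 := mul_le_mul_of_nonneg_left (sq_le_arcosh_sq_add (A - B) hs)
    (by linarith : 0 ≤ (1 + τ) / 2)
  have h2 := mul_le_mul_of_nonneg_left (sq_le_arcosh_sq_add (A + B) hs)
    (by linarith : 0 ≤ (1 - τ) / 2)
  rw [Real.cosh_sub] at h1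
  rw [Real.cosh_add] at h2
  have hz : poincG s / 2 * (Real.cosh A * Real.cosh B - τ * (Real.sinh A * Real.sinh B)
      - (1 + 2 * s)) = 0 := by
    rw [← hτ']; ring
  rw [hτ']
  have e : B / (2 * Real.sinh B) * (4 * A / Real.sinh A * (τ * (Real.sinh A * Real.sinh B)))
      = 2 * A * B * τ := by
    field_simp
    ring
  rw [e]
  linarith

section Ball

variable {E : Type*} [NormedAddCommGroup E] {κ : ℝ} {x z : E}

/-- The quantity `v` with `1 + 2 v = cosh (√κ d(x, z))` in the Poincaré ball of curvature `-κ`. -/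
noncomputable def poincV (κ : ℝ) (x z : E) : ℝ :=
  κ * ‖x - z‖ ^ 2 / ((1 - κ * ‖x‖ ^ 2) * (1 - κ * ‖z‖ ^ 2))

theorem poincV_nonneg (hκ : 0 ≤ κ) (hx : κ * ‖x‖ ^ 2 < 1) (hz : κ * ‖z‖ ^ 2 < 1) :
    0 ≤ poincV κ x z :=
  div_nonneg (by positivity) (mul_nonneg (sub_pos.2 hx).le (sub_pos.2 hz).le)

theorem poincV_pos (hκ : 0 < κ) (hx : κ * ‖x‖ ^ 2 < 1) (hz : κ * ‖z‖ ^ 2 < 1) (hxz : x ≠ z) :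
    0 < poincV κ x z := by
  have := norm_pos_iff.2 (sub_ne_zero.2 hxz)
  exact div_pos (by positivity) (mul_pos (sub_pos.2 hx) (sub_pos.2 hz))

@[simp]
theorem poincV_self : poincV κ x x = 0 := by simp [poincV]

end Ball

section Hyperboloid

variable {E : Type*} [NormedAddCommGroup E] [InnerProductSpace ℝ E]

open scoped RealInnerProductSpace

/-- Gram inequality for three points of the hyperboloid `X₀² = 1 + ‖X‖²`. -/
theorem hyperboloid_gram_le {X₀ Y₀ Z₀ : ℝ} {X Y Z : E} (hX : X₀ ^ 2 = 1 + ‖X‖ ^ 2)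
    (hY : Y₀ ^ 2 = 1 + ‖Y‖ ^ 2) (hY₀ : 0 < Y₀) (hZ : Z₀ ^ 2 = 1 + ‖Z‖ ^ 2) :
    ((X₀ * Y₀ - ⟪X, Y⟫) * (Y₀ * Z₀ - ⟪Y, Z⟫) - (X₀ * Z₀ - ⟪X, Z⟫)) ^ 2 ≤
      ((X₀ * Y₀ - ⟪X, Y⟫) ^ 2 - 1) * ((Y₀ * Z₀ - ⟪Y, Z⟫) ^ 2 - 1) := by
  set p := X₀ * Y₀ - ⟪X, Y⟫ with hp
  set q := Y₀ * Z₀ - ⟪Y, Z⟫ with hq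
  have hY1 : Y₀ + 1 ≠ 0 := by positivity
  have hXY : ⟪X, Y⟫ = X₀ * Y₀ - p := by rw [hp]; ring
  have hYZ : ⟪Y, Z⟫ = Y₀ * Z₀ - q := by rw [hq]; ring
  have hYY : ⟪Y, Y⟫ = Y₀ ^ 2 - 1 := by rw [real_inner_self_eq_norm_sq]; linarith
  have hXX : ⟪X, X⟫ = X₀ ^ 2 - 1 := by rw [real_inner_self_eq_norm_sq]; linarith
  have hZZ : ⟪Z, Z⟫ = Z₀ ^ 2 - 1 := by rw [real_inner_self_eq_norm_sq]; linarith
  have e₁ : ⟪X - ((X₀ + p) / (Y₀ + 1)) • Y, Z - ((Z₀ + q) / (Y₀ + 1)) • Y⟫ =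
      p * q - (X₀ * Z₀ - ⟪X, Z⟫) := by
    simp only [inner_sub_left, inner_sub_right, real_inner_smul_left, real_inner_smul_right,
      hXY, hYZ, hYY]
    field_simp
    ring
  have e₂ : ⟪X - ((X₀ + p) / (Y₀ + 1)) • Y, X - ((X₀ + p) / (Y₀ + 1)) • Y⟫ = p ^ 2 - 1 := by
    simp only [inner_sub_left, inner_sub_right, real_inner_smul_left, real_inner_smul_right,
      real_inner_comm X Y, hXY, hYY, hXX]
    field_simp
    ring
  have e₃ : ⟪Z - ((Z₀ + q) / (Y₀ + 1)) • Y, Z - ((Z₀ + q) / (Y₀ + 1)) • Y⟫ = q ^ 2 - 1 := by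
    simp only [inner_sub_left, inner_sub_right, real_inner_smul_left, real_inner_smul_right,
      real_inner_comm Y Z, hYZ, hYY, hZZ]
    field_simp
    ring
  have h := real_inner_mul_inner_self_le (X - ((X₀ + p) / (Y₀ + 1)) • Y)
    (Z - ((Z₀ + q) / (Y₀ + 1)) • Y)
  rw [e₁, e₂, e₃] at h
  linarith

variable {κ : ℝ} {x y z : E}

theorem one_add_two_mul_poincV (hx : κ * ‖x‖ ^ 2 < 1) (hz : κ * ‖z‖ ^ 2 < 1) :
    1 + 2 * poincV κ x z = ((1 + κ * ‖x‖ ^ 2) * (1 + κ * ‖z‖ ^ 2) - 4 * κ * ⟪x, z⟫) /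
      ((1 - κ * ‖x‖ ^ 2) * (1 - κ * ‖z‖ ^ 2)) := by
  have h₁ := (sub_pos.2 hx).ne'
  have h₂ := (sub_pos.2 hz).ne'
  rw [poincV, norm_sub_sq_real]
  field_simp
  ring

theorem poincV_gram_le (hκ : 0 ≤ κ) (hx : κ * ‖x‖ ^ 2 < 1) (hy : κ * ‖y‖ ^ 2 < 1)
    (hz : κ * ‖z‖ ^ 2 < 1) :
    ((1 + 2 * poincV κ x y) * (1 + 2 * poincV κ y z) - (1 + 2 * poincV κ x z)) ^ 2 ≤
      ((1 + 2 * poincV κ x y) ^ 2 - 1) * ((1 + 2 * poincV κ y z) ^ 2 - 1) := by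
  have lift_sq : ∀ u : E, κ * ‖u‖ ^ 2 < 1 → ((1 + κ * ‖u‖ ^ 2) / (1 - κ * ‖u‖ ^ 2)) ^ 2 =
      1 + ‖(2 * √κ / (1 - κ * ‖u‖ ^ 2)) • u‖ ^ 2 := by
    intro u hu
    have := (sub_pos.2 hu).ne'
    rw [norm_smul, mul_pow, Real.norm_eq_abs, sq_abs, div_pow, div_pow, mul_pow, Real.sq_sqrt hκ]
    field_simp
    ring
  have lift_inner : ∀ u v : E, κ * ‖u‖ ^ 2 < 1 → κ * ‖v‖ ^ 2 < 1 → 1 + 2 * poincV κ u v =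
      (1 + κ * ‖u‖ ^ 2) / (1 - κ * ‖u‖ ^ 2) * ((1 + κ * ‖v‖ ^ 2) / (1 - κ * ‖v‖ ^ 2)) -
        ⟪(2 * √κ / (1 - κ * ‖u‖ ^ 2)) • u, (2 * √κ / (1 - κ * ‖v‖ ^ 2)) • v⟫ := by
    intro u v hu hv
    have h₁ := (sub_pos.2 hu).ne'
    have h₂ := (sub_pos.2 hv).ne'
    rw [one_add_two_mul_poincV hu hv, real_inner_smul_left, real_inner_smul_right]
    field_simp
    rw [Real.sq_sqrt hκ]
    ring
  rw [lift_inner x y hx hy, lift_inner y z hy hz, lift_inner x z hx hz]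
  exact hyperboloid_gram_le (lift_sq x hx) (lift_sq y hy)
    (div_pos (by positivity) (sub_pos.2 hy)) (lift_sq z hz)

/-- A positively weighted sum of points of the hyperboloid is a positive multiple of a point of
the hyperboloid, whose position in the Poincaré ball is given by the update formula. -/
theorem exists_sum_mul_poincV_eq {ι : Type*} [Fintype ι] [Nonempty ι] (hκ : 0 < κ)
    {x : ι → E} (hx : ∀ l, κ * ‖x l‖ ^ 2 < 1) {α : ι → ℝ} (hα : ∀ l, 0 < α l)
    {P : ℝ} {b u : E} [Decidable (b = 0)] (hP : P = ∑ l, α l * (1 + κ * ‖x l‖ ^ 2))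
    (hb : b = ∑ l, α l • x l)
    (hu : u = if b = 0 then 0 else
      ((P - √(P ^ 2 - 4 * κ * ‖b‖ ^ 2)) / (2 * κ * ‖b‖ ^ 2)) • b) :
    κ * ‖u‖ ^ 2 < 1 ∧ ∃ m > 0, ∀ z : E, κ * ‖z‖ ^ 2 < 1 →
      ∑ l, α l * (1 - κ * ‖x l‖ ^ 2) * (1 + 2 * poincV κ (x l) z) =
        m * (1 + 2 * poincV κ u z) := by
  have hbP : 2 * √κ * ‖b‖ < P := by
    calc 2 * √κ * ‖b‖ ≤ 2 * √κ * ∑ l, α l * ‖x l‖ := by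
          gcongr
          rw [hb]
          refine (norm_sum_le _ _).trans_eq (Finset.sum_congr rfl fun l _ => ?_)
          rw [norm_smul, Real.norm_of_nonneg (hα l).le]
      _ = ∑ l, α l * (2 * (√κ * ‖x l‖)) := by
          rw [Finset.mul_sum]
          exact Finset.sum_congr rfl fun l _ => by ring
      _ < P := by
          rw [hP]
          refine Finset.sum_lt_sum_of_nonempty Finset.univ_nonempty fun l _ => ?_
          refine mul_lt_mul_of_pos_left ?_ (hα l)
          have h₁ : κ * ‖x l‖ ^ 2 = (√κ * ‖x l‖) ^ 2 := by rw [mul_pow, Real.sq_sqrt hκ.le]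
          have h₂ := hx l
          rw [h₁] at h₂ ⊢
          nlinarith [(sq_lt_one_iff₀ (by positivity)).1 h₂]
  have hP0 : 0 < P := lt_of_le_of_lt (by positivity) hbP
  have hdisc : 0 < P ^ 2 - 4 * κ * ‖b‖ ^ 2 := by
    have h := pow_lt_pow_left₀ hbP (by positivity) two_ne_zero
    rw [mul_pow, mul_pow, Real.sq_sqrt hκ.le] at h
    linarith
  set m := √(P ^ 2 - 4 * κ * ‖b‖ ^ 2) with hm
  have hm0 : 0 < m := Real.sqrt_pos.2 hdisc
  have hm2 : m ^ 2 = P ^ 2 - 4 * κ * ‖b‖ ^ 2 := Real.sq_sqrt hdisc.le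
  have hPm : 0 < P + m := by positivity
  have hu' : u = (2 / (P + m)) • b := by
    rw [hu]
    split_ifs with h0
    · simp [h0]
    · have := norm_pos_iff.2 h0
      congr 1
      field_simp
      linarith
  have hub : κ * ‖u‖ ^ 2 = (P - m) / (P + m) := by
    rw [hu', norm_smul, mul_pow, Real.norm_eq_abs, sq_abs]
    field_simp
    linarith
  have hu1 : κ * ‖u‖ ^ 2 < 1 := by
    rw [hub, div_lt_one hPm]
    linarith
  refine ⟨hu1, m, hm0, fun z hz => ?_⟩
  have hz' := (sub_pos.2 hz).ne'
  have hinner : ⟪b, z⟫ = ∑ l, α l * ⟪x l, z⟫ := by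
    rw [hb, sum_inner]
    simp only [real_inner_smul_left]
  calc ∑ l, α l * (1 - κ * ‖x l‖ ^ 2) * (1 + 2 * poincV κ (x l) z)
      = ∑ l, (α l * (1 + κ * ‖x l‖ ^ 2) * ((1 + κ * ‖z‖ ^ 2) / (1 - κ * ‖z‖ ^ 2)) -
          α l * ⟪x l, z⟫ * (4 * κ / (1 - κ * ‖z‖ ^ 2))) := by
        refine Finset.sum_congr rfl fun l _ => ?_
        have := (sub_pos.2 (hx l)).ne'
        rw [one_add_two_mul_poincV (hx l) hz]
        field_simp
    _ = P * ((1 + κ * ‖z‖ ^ 2) / (1 - κ * ‖z‖ ^ 2)) -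
          ⟪b, z⟫ * (4 * κ / (1 - κ * ‖z‖ ^ 2)) := by
        rw [Finset.sum_sub_distrib, ← Finset.sum_mul, ← Finset.sum_mul, ← hP, ← hinner]
    _ = m * (1 + 2 * poincV κ u z) := by
        rw [one_add_two_mul_poincV hu1 hz, hub, hu', real_inner_smul_left,
          show 1 + (P - m) / (P + m) = 2 * P / (P + m) by field_simp; ring,
          show 1 - (P - m) / (P + m) = 2 * m / (P + m) by field_simp; ring]
        field_simp

end Hyperboloid

/-- descent property of one step of the Poincaré-ball Fréchet mean
algorithm: `f(y⁺) ≤ f(y)`, strictly if `y` is not a minimizer of `f` over the ball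
`D = {y : |K|‖y‖² < 1}`. -/
theorem poincare_frechet_mean_step_descent
    (n t : ℕ) (ht : 0 < t) (K : ℝ) (hK : K < 0)
    (x : Fin t → EuclideanSpace ℝ (Fin n))
    (hx : ∀ l, |K| * ‖x l‖ ^ 2 < 1)
    (w : Fin t → ℝ) (hw : ∀ l, 0 < w l)
    (v : EuclideanSpace ℝ (Fin n) → Fin t → ℝ)
    (hv : ∀ z l, v z l = |K| * ‖x l - z‖ ^ 2 /
      ((1 - |K| * ‖x l‖ ^ 2) * (1 - |K| * ‖z‖ ^ 2)))
    (f : EuclideanSpace ℝ (Fin n) → ℝ)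
    (hf : ∀ z, f z = ∑ l, (w l / |K|) * (arcosh (1 + 2 * v z l)) ^ 2)
    (y : EuclideanSpace ℝ (Fin n)) (hy : |K| * ‖y‖ ^ 2 < 1)
    (α : Fin t → ℝ)
    (hα : ∀ l, α l = w l * poincG (v y l) / (1 - |K| * ‖x l‖ ^ 2))
    (a c : ℝ) (b : EuclideanSpace ℝ (Fin n))
    (ha : a = ∑ l, α l)
    (hb : b = ∑ l, α l • x l)
    (hc : c = ∑ l, α l * ‖x l‖ ^ 2)
    (yplus : EuclideanSpace ℝ (Fin n))
    (hyplus : yplus = if b = 0 then 0 else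
      (((a + c * |K|) - Real.sqrt ((a + c * |K|) ^ 2 - 4 * |K| * ‖b‖ ^ 2)) /
        (2 * |K| * ‖b‖ ^ 2)) • b) :
    f yplus ≤ f y ∧
    ((¬ ∀ z : EuclideanSpace ℝ (Fin n), |K| * ‖z‖ ^ 2 < 1 → f y ≤ f z) →
      f yplus < f y) := by
  set κ := |K|
  have hκ : 0 < κ := abs_pos.2 hK.ne
  have : Nonempty (Fin t) := ⟨⟨0, ht⟩⟩
  obtain rfl : v = fun z l => poincV κ (x l) z := funext fun z => funext fun l => hv z l
  have hα0 : ∀ l, 0 < α l := fun l => by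
    rw [hα]
    exact div_pos (mul_pos (hw l) (poincG_pos _)) (sub_pos.2 (hx l))
  have hω : ∀ l, α l * (1 - κ * ‖x l‖ ^ 2) = w l * poincG (poincV κ (x l) y) := fun l => by
    rw [hα, div_mul_cancel₀ _ (sub_pos.2 (hx l)).ne']
  have hP : a + c * κ = ∑ l, α l * (1 + κ * ‖x l‖ ^ 2) := by
    rw [ha, hc, Finset.sum_mul, ← Finset.sum_add_distrib]
    exact Finset.sum_congr rfl fun l _ => by ring
  obtain ⟨hyp, m, hm, hsum⟩ := exists_sum_mul_poincV_eq hκ hx hα0 hP hb hyplus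
  simp only [hω] at hsum
  have hstep : f yplus ≤ f y - m / κ * poincV κ yplus y := by
    have key : f yplus ≤ ∑ l, (w l / κ * arcosh (1 + 2 * poincV κ (x l) y) ^ 2 +
        (w l * poincG (poincV κ (x l) y) * (1 + 2 * poincV κ (x l) yplus) -
          w l * poincG (poincV κ (x l) y) * (1 + 2 * poincV κ (x l) y)) / (2 * κ)) := by
      rw [hf]
      refine Finset.sum_le_sum fun l _ => ?_
      have h := sq_le_arcosh_sq_add (arcosh (1 + 2 * poincV κ (x l) yplus))
        (poincV_nonneg hκ.le (hx l) hy)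
      rw [cosh_arcosh_one_add (poincV_nonneg hκ.le (hx l) hyp)] at h
      refine (mul_le_mul_of_nonneg_left h (div_pos (hw l) hκ).le).trans_eq ?_
      field_simp
    rw [Finset.sum_add_distrib, ← hf, ← Finset.sum_div, Finset.sum_sub_distrib, hsum _ hyp,
      hsum _ hy, poincV_self] at key
    refine key.trans_eq ?_
    field_simp
    ring
  refine ⟨hstep.trans (sub_le_self _ ?_), fun hmin => hstep.trans_lt (sub_lt_self _ ?_)⟩
  · exact mul_nonneg (div_pos hm hκ).le (poincV_nonneg hκ.le hyp hy)
  refine mul_pos (div_pos hm hκ) (poincV_pos hκ hyp hy ?_)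
  rintro rfl
  refine hmin fun z hz => ?_
  rcases eq_or_ne yplus z with rfl | hne
  · exact le_rfl
  have hr := poincV_pos hκ hyp hz hne
  set B := arcosh (1 + 2 * poincV κ yplus z)
  have key : ∑ l, (w l / κ * arcosh (1 + 2 * poincV κ (x l) yplus) ^ 2 + w l / κ * B ^ 2 -
      (w l * poincG (poincV κ (x l) yplus) * (1 + 2 * poincV κ (x l) yplus) *
        (1 + 2 * poincV κ yplus z) -
        w l * poincG (poincV κ (x l) yplus) * (1 + 2 * poincV κ (x l) z)) *
        (B / (2 * Real.sinh B) / κ)) ≤ f z := by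
    rw [hf]
    refine Finset.sum_le_sum fun l _ => ?_
    have h := arcosh_sq_add_le (poincV_nonneg hκ.le (hx l) hyp) hr
      (poincV_nonneg hκ.le (hx l) hz) (poincV_gram_le hκ.le (hx l) hyp hz)
    refine Eq.trans_le ?_ (mul_le_mul_of_nonneg_left h (div_pos (hw l) hκ).le)
    ring
  rw [Finset.sum_sub_distrib, Finset.sum_add_distrib, ← hf, ← Finset.sum_mul,
    ← Finset.sum_mul, Finset.sum_sub_distrib, ← Finset.sum_mul, hsum _ hyp, hsum _ hz,
    poincV_self] at key
  have hB : 0 ≤ (∑ l, w l / κ) * B ^ 2 :=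
    mul_nonneg (Finset.sum_nonneg fun l _ => (div_pos (hw l) hκ).le) (sq_nonneg _)
  linarith
end
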